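/- L∞–L∞ decay estimate for first vector-field derivatives (Lemma 10.2): there is a universal constant C such that the following holds. Let 0 < ε̃ ≤ 1 and let φ be a smooth solution on [0,T] × ℝ³ of g^{αβ}∂_α∂_βφ = F, where H^{αβ} = g^{αβ} − m^{αβ} satisfies, in the region t/2 ≤ |x| ≤ 2t, Σ_{|I|≤1} |Z^I H| ≤ ε̃/4 and Σ_{|I|≤1} |Z^I H|_{LL} + |H|_{L𝒯} ≤ (ε̃/4)(1+|q|)/(1+t+|x|). Then for all 0 ≤ t ≤ T and x ∈ ℝ³, (1+t+|x|) Σ_{|I|≤1} |∂Z^Iφ(t,x)| ≤ C sup_{0≤τ≤t} ((1+t)/(1+τ))^{Cε̃} Σ_{|I|≤2} ‖Z^Iφ(τ,·)‖_{L∞} + C ∫₀^t ((1+t)/(1+τ))^{Cε̃} [ Σ_{|I|≤1} (1+τ)‖Z^I F(τ,·)‖_{L∞(D_τ)} + Σ_{|I|≤3} (1+τ)^{−1} ‖Z^Iφ(τ,·)‖_{L∞(D_τ)} ] dτ, where D_τ = {x : τ/2 ≤ |x| ≤ 2τ}. -/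

import Mathlib

open scoped BigOperators ENNReal
open MeasureTheory

noncomputable section

namespace LindbladRodnianski

/-- Minkowski metric `diag(-1,1,1,1)` (numerically the same with indices up or down). -/
def mink (α β : Fin 4) : ℝ := if α = β then (if α = 0 then -1 else 1) else 0

/-- spatial part of a spacetime point -/
def sp (y : Fin 4 → ℝ) : Fin 3 → ℝ := fun i => y i.succ

/-- Euclidean norm on `Fin 3 → ℝ` -/
def nr3 (x : Fin 3 → ℝ) : ℝ := Real.sqrt (∑ i : Fin 3, x i ^ 2)

/-- r = |x| -/
def rad (y : Fin 4 → ℝ) : ℝ := nr3 (sp y)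

/-- the unit spatial direction ω = x/|x| -/
def uom (y : Fin 4 → ℝ) : Fin 3 → ℝ := fun i => sp y i / rad y

/-- q = r - t -/
def qq (y : Fin 4 → ℝ) : ℝ := rad y - y 0

/-- combine a time and a space point into a spacetime point -/
def tins (t : ℝ) (x : Fin 3 → ℝ) : Fin 4 → ℝ := Fin.cons t x

/-- L = (1, ω) (indices up) -/
def vecL (ω : Fin 3 → ℝ) : Fin 4 → ℝ := ![1, ω 0, ω 1, ω 2]
/-- L̄ = (1, -ω) (indices up) -/
def vecLb (ω : Fin 3 → ℝ) : Fin 4 → ℝ := ![1, -ω 0, -ω 1, -ω 2]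
/-- L with index lowered by m -/
def vecLlow (ω : Fin 3 → ℝ) : Fin 4 → ℝ := ![-1, ω 0, ω 1, ω 2]
/-- L̄ with index lowered by m -/
def vecLblow (ω : Fin 3 → ℝ) : Fin 4 → ℝ := ![-1, -ω 0, -ω 1, -ω 2]
/-- a spatial vector viewed as a spacetime vector -/
def spat (s : Fin 3 → ℝ) : Fin 4 → ℝ := ![0, s 0, s 1, s 2]

/-- `ω, s₁, s₂` is an (ordered) orthonormal frame of ℝ³;
equivalently `s₁, s₂` is an orthonormal basis of the plane orthogonal to the unit vector ω. -/
def IsFrame (ω s₁ s₂ : Fin 3 → ℝ) : Prop :=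
  (∑ i : Fin 3, ω i * ω i) = 1 ∧ (∑ i : Fin 3, s₁ i * s₁ i) = 1 ∧
  (∑ i : Fin 3, s₂ i * s₂ i) = 1 ∧ (∑ i : Fin 3, s₁ i * s₂ i) = 0 ∧
  (∑ i : Fin 3, ω i * s₁ i) = 0 ∧ (∑ i : Fin 3, ω i * s₂ i) = 0

/-- contraction of a 2-tensor with two vectors: `p_{αβ} U^α V^β` -/
def con2 (p : Fin 4 → Fin 4 → ℝ) (U V : Fin 4 → ℝ) : ℝ :=
  ∑ α : Fin 4, ∑ β : Fin 4, p α β * U α * V β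

/-- Euclidean norm of a 2-tensor -/
def tnorm (p : Fin 4 → Fin 4 → ℝ) : ℝ :=
  Real.sqrt (∑ α : Fin 4, ∑ β : Fin 4, (p α β) ^ 2)

/-- coordinate derivative ∂_α f -/
def pd (f : (Fin 4 → ℝ) → ℝ) (α : Fin 4) (y : Fin 4 → ℝ) : ℝ :=
  fderiv ℝ f y (Pi.single α 1)

/-- ∂_α ∂_β f -/
def pd2 (f : (Fin 4 → ℝ) → ℝ) (α β : Fin 4) (y : Fin 4 → ℝ) : ℝ :=
  pd (pd f β) α y

/-- |∂f| -/
def dnorm (f : (Fin 4 → ℝ) → ℝ) (y : Fin 4 → ℝ) : ℝ :=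
  Real.sqrt (∑ α : Fin 4, (pd f α y) ^ 2)

/-- ω extended by ω₀ = 0 to a spacetime vector -/
def uom4 (y : Fin 4 → ℝ) : Fin 4 → ℝ := spat (uom y)

/-- radial derivative ∂_r f = ω^j ∂_j f -/
def pdr (f : (Fin 4 → ℝ) → ℝ) (y : Fin 4 → ℝ) : ℝ :=
  ∑ α : Fin 4, uom4 y α * pd f α y

/-- ∂_q = ½(∂_r - ∂_t) -/
def pdq (f : (Fin 4 → ℝ) → ℝ) (y : Fin 4 → ℝ) : ℝ := (pdr f y - pd f 0 y) / 2

/-- ∂_s = ½(∂_t + ∂_r) -/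
def pds (f : (Fin 4 → ℝ) → ℝ) (y : Fin 4 → ℝ) : ℝ := (pd f 0 y + pdr f y) / 2

/-- the tangential derivatives: index 0 is ∂_s, index i.succ is ∂̄_i = ∂_i - ω_i ω^j ∂_j -/
def tpd (f : (Fin 4 → ℝ) → ℝ) (a : Fin 4) (y : Fin 4 → ℝ) : ℝ :=
  if a = 0 then pds f y else pd f a y - uom4 y a * pdr f y

/-- |∂̄f| -/
def tdnorm (f : (Fin 4 → ℝ) → ℝ) (y : Fin 4 → ℝ) : ℝ :=
  Real.sqrt (∑ a : Fin 4, (tpd f a y) ^ 2)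

/-- coordinates with the index lowered: x₀ = -t, x_i = xⁱ -/
def lowerc (y : Fin 4 → ℝ) (α : Fin 4) : ℝ := if α = 0 then -(y 0) else y α

/-- the translation vector field ∂_μ (its coefficients) -/
def dVF (μ : Fin 4) : (Fin 4 → ℝ) → Fin 4 → ℝ := fun _ => Pi.single μ 1

/-- the rotation/boost field Ω_{ab} = x_a ∂_b - x_b ∂_a (its coefficients) -/
def omVF (a b : Fin 4) : (Fin 4 → ℝ) → Fin 4 → ℝ :=
  fun y ν => lowerc y a * (if ν = b then (1:ℝ) else 0) - lowerc y b * (if ν = a then (1:ℝ) else 0)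

/-- the scaling field S = t∂_t + x^i∂_i (its coefficients) -/
def sVF : (Fin 4 → ℝ) → Fin 4 → ℝ := fun y => y

/-- the family 𝒵 of Minkowski vector fields -/
def ZV : Fin 11 → (Fin 4 → ℝ) → Fin 4 → ℝ :=
  ![dVF 0, dVF 1, dVF 2, dVF 3,
    omVF 0 1, omVF 0 2, omVF 0 3, omVF 1 2, omVF 1 3, omVF 2 3, sVF]

/-- apply a vector field (given by its coefficients) to a function -/
def Zap (Zc : (Fin 4 → ℝ) → Fin 4 → ℝ) (f : (Fin 4 → ℝ) → ℝ) (y : Fin 4 → ℝ) : ℝ :=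
  ∑ μ : Fin 4, Zc y μ * pd f μ y

/-- the Minkowski wave operator □ = m^{αβ}∂_α∂_β = -∂_t² + Δ -/
def box (f : (Fin 4 → ℝ) → ℝ) (y : Fin 4 → ℝ) : ℝ :=
  ∑ α : Fin 4, ∑ β : Fin 4, mink α β * pd2 f α β y

/-- the reduced wave operator □̃_g = □ + H^{αβ}∂_α∂_β with g = m + H (indices up) -/
def boxg (H : (Fin 4 → ℝ) → Fin 4 → Fin 4 → ℝ) (f : (Fin 4 → ℝ) → ℝ) (y : Fin 4 → ℝ) : ℝ :=
  box f y + ∑ α : Fin 4, ∑ β : Fin 4, H y α β * pd2 f α β y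

/-- |k|_{L𝒯} for an index-up 2-tensor (contractions with lowered frame vectors) -/
def normLT (k : Fin 4 → Fin 4 → ℝ) (ω s₁ s₂ : Fin 3 → ℝ) : ℝ :=
  |con2 k (vecLlow ω) (vecLlow ω)| + |con2 k (vecLlow ω) (spat s₁)| +
    |con2 k (vecLlow ω) (spat s₂)|

/-- the region D_t = {x : t/2 ≤ |x| ≤ 2t} -/
def Dreg (t : ℝ) : Set (Fin 3 → ℝ) := {x | t / 2 ≤ nr3 x ∧ nr3 x ≤ 2 * t}


/-- ‖ψ(τ,·)‖_{L∞(ℝ³)} valued in ℝ≥0∞ -/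
def esup (ψ : (Fin 4 → ℝ) → ℝ) (τ : ℝ) : ℝ≥0∞ :=
  ⨆ x : Fin 3 → ℝ, ENNReal.ofReal |ψ (tins τ x)|

/-- ‖ψ(τ,·)‖_{L∞(D_τ)} valued in ℝ≥0∞ -/
def esupD (ψ : (Fin 4 → ℝ) → ℝ) (τ : ℝ) : ℝ≥0∞ :=
  ⨆ x ∈ Dreg τ, ENNReal.ofReal |ψ (tins τ x)|

/-- the tensor Z H, componentwise application of the vector field Z -/
def Zten (Zc : (Fin 4 → ℝ) → Fin 4 → ℝ) (H : (Fin 4 → ℝ) → Fin 4 → Fin 4 → ℝ)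
    (y : Fin 4 → ℝ) : Fin 4 → Fin 4 → ℝ :=
  fun α β => Zap Zc (fun z => H z α β) y

/-- contraction of the `i`-th field with a covector -/
def zdot (i : Fin 11) (y p : Fin 4 → ℝ) : ℝ := ∑ μ : Fin 4, ZV i y μ * p μ

/-- total size of a covector measured against all the fields -/
def zsum (y p : Fin 4 → ℝ) : ℝ := ∑ i : Fin 11, |zdot i y p|

/-- the contraction of a covector with `T_α = ∂_α + ½ L_α L̄` -/
def tdot (ω : Fin 3 → ℝ) (α : Fin 4) (p : Fin 4 → ℝ) : ℝ :=
  p α + vecLlow ω α * (∑ μ : Fin 4, vecLb ω μ * p μ) / 2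

lemma zdot_zero (y p : Fin 4 → ℝ) : zdot 0 y p = p 0 := by
  simp [zdot, ZV, dVF, Fin.sum_univ_four]

lemma zdot_one (y p : Fin 4 → ℝ) : zdot 1 y p = p 1 := by
  simp [zdot, ZV, dVF, Fin.sum_univ_four]

lemma zdot_two (y p : Fin 4 → ℝ) : zdot 2 y p = p 2 := by
  simp [zdot, ZV, dVF, Pi.single_apply]

lemma zdot_three (y p : Fin 4 → ℝ) : zdot 3 y p = p 3 := by
  simp [zdot, ZV, dVF, Pi.single_apply]

lemma zdot_four (y p : Fin 4 → ℝ) : zdot 4 y p = -(y 0) * p 1 - y 1 * p 0 := by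
  simp [zdot, ZV, omVF, lowerc, Fin.sum_univ_four]; ring

lemma zdot_five (y p : Fin 4 → ℝ) : zdot 5 y p = -(y 0) * p 2 - y 2 * p 0 := by
  simp [zdot, ZV, omVF, lowerc, Fin.sum_univ_four]; ring

lemma zdot_six (y p : Fin 4 → ℝ) : zdot 6 y p = -(y 0) * p 3 - y 3 * p 0 := by
  simp [zdot, ZV, omVF, lowerc, Fin.sum_univ_four]; ring

lemma zdot_seven (y p : Fin 4 → ℝ) : zdot 7 y p = y 1 * p 2 - y 2 * p 1 := by
  simp [zdot, ZV, omVF, lowerc, Fin.sum_univ_four]; ring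

lemma zdot_eight (y p : Fin 4 → ℝ) : zdot 8 y p = y 1 * p 3 - y 3 * p 1 := by
  simp [zdot, ZV, omVF, lowerc, Fin.sum_univ_four]; ring

lemma zdot_nine (y p : Fin 4 → ℝ) : zdot 9 y p = y 2 * p 3 - y 3 * p 2 := by
  simp [zdot, ZV, omVF, lowerc, Fin.sum_univ_four]; ring

lemma zdot_ten (y p : Fin 4 → ℝ) :
    zdot 10 y p = y 0 * p 0 + y 1 * p 1 + y 2 * p 2 + y 3 * p 3 := by
  simp [zdot, ZV, sVF, Fin.sum_univ_four]

lemma zsum_eq (y p : Fin 4 → ℝ) : zsum y p =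
    |zdot 0 y p| + |zdot 1 y p| + |zdot 2 y p| + |zdot 3 y p| + |zdot 4 y p| + |zdot 5 y p|
      + |zdot 6 y p| + |zdot 7 y p| + |zdot 8 y p| + |zdot 9 y p| + |zdot 10 y p| := by
  simp only [zsum, Fin.sum_univ_succ, Fin.sum_univ_zero]
  simp only [Fin.succ_zero_eq_one, add_zero, add_assoc]
  rfl

lemma zsum_nonneg (y p : Fin 4 → ℝ) : 0 ≤ zsum y p :=
  Finset.sum_nonneg fun _ _ => abs_nonneg _

lemma abs_zdot_le (i : Fin 11) (y p : Fin 4 → ℝ) : |zdot i y p| ≤ zsum y p :=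
  Finset.single_le_sum (f := fun i => |zdot i y p|) (fun _ _ => abs_nonneg _) (Finset.mem_univ i)

lemma abs_le_zsum (α : Fin 4) (y p : Fin 4 → ℝ) : |p α| ≤ zsum y p := by
  fin_cases α
  · simpa [zdot_zero] using abs_zdot_le 0 y p
  · simpa [zdot_one] using abs_zdot_le 1 y p
  · simpa [zdot_two] using abs_zdot_le 2 y p
  · simpa [zdot_three] using abs_zdot_le 3 y p

lemma rad_nonneg (y : Fin 4 → ℝ) : 0 ≤ rad y := Real.sqrt_nonneg _

lemma rad_sq (y : Fin 4 → ℝ) : rad y ^ 2 = y 1 ^ 2 + y 2 ^ 2 + y 3 ^ 2 := by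
  unfold rad nr3
  rw [Real.sq_sqrt (Finset.sum_nonneg fun _ _ => sq_nonneg _)]
  simp [sp, Fin.sum_univ_three]

lemma abs_coord_le_rad (y : Fin 4 → ℝ) : |y 1| ≤ rad y ∧ |y 2| ≤ rad y ∧ |y 3| ≤ rad y := by
  have h := rad_sq y
  have h0 := rad_nonneg y
  refine ⟨?_, ?_, ?_⟩ <;> apply abs_le_of_sq_le_sq _ h0 <;> nlinarith [sq_nonneg (y 1), sq_nonneg (y 2), sq_nonneg (y 3)]

lemma abs_lin_comb_le {s a b c d : ℝ} (z w u v : ℝ) (ha : |a| ≤ s) (hb : |b| ≤ s)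
    (hc : |c| ≤ s) (hd : |d| ≤ s) :
    |a * z + b * w + c * u + d * v| ≤ s * (|z| + |w| + |u| + |v|) := by
  have key : ∀ a b : ℝ, |a| ≤ s → |a * b| ≤ s * |b| := fun a b h => by
    rw [abs_mul]; exact mul_le_mul_of_nonneg_right h (abs_nonneg _)
  have h1 := abs_add_le (a * z + b * w + c * u) (d * v)
  have h2 := abs_add_le (a * z + b * w) (c * u)
  have h3 := abs_add_le (a * z) (b * w)
  linarith [key a z ha, key b w hb, key c u hc, key d v hd]

lemma abs_qq_mul_le_zsum (α : Fin 4) (y p : Fin 4 → ℝ) (hy : 0 ≤ y 0) :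
    |qq y| * |p α| ≤ zsum y p := by
  have hr := rad_nonneg y
  obtain ⟨h1, h2, h3⟩ := abs_coord_le_rad y
  have hsq := rad_sq y
  set s := y 0 + rad y with hs
  have hs0 : 0 ≤ s := by positivity
  have a0 : |y 0| ≤ s := by rw [abs_of_nonneg hy]; linarith
  have a1 : |y 1| ≤ s := by linarith
  have a2 : |y 2| ≤ s := by linarith
  have a3 : |y 3| ≤ s := by linarith
  have b0 : |-y 0| ≤ s := by rwa [abs_neg]
  have b1 : |-y 1| ≤ s := by rwa [abs_neg]
  have b2 : |-y 2| ≤ s := by rwa [abs_neg]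
  have b3 : |-y 3| ≤ s := by rwa [abs_neg]
  have main : |s * qq y * p α| ≤ s * zsum y p := by
    have e : s * qq y = y 1 ^ 2 + y 2 ^ 2 + y 3 ^ 2 - y 0 ^ 2 := by
      rw [← hsq]; simp only [hs, qq]; ring
    have fin : ∀ {a b c d : ℝ} (z w u v : ℝ), |a| ≤ s → |b| ≤ s → |c| ≤ s → |d| ≤ s →
        |z| + |w| + |u| + |v| ≤ zsum y p →
        s * qq y * p α = a * z + b * w + c * u + d * v →
        |s * qq y * p α| ≤ s * zsum y p := fun z w u v ha hb hc hd hz he => by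
      rw [he]
      exact (abs_lin_comb_le z w u v ha hb hc hd).trans (mul_le_mul_of_nonneg_left hz hs0)
    have pos : ∀ i, 0 ≤ |zdot i y p| := fun i => abs_nonneg _
    have hz := zsum_eq y p
    fin_cases α
    · refine fin (zdot 10 y p) (zdot 4 y p) (zdot 5 y p) (zdot 6 y p) b0 b1 b2 b3 ?_ ?_
      · linarith [pos 0, pos 1, pos 2, pos 3, pos 7, pos 8, pos 9]
      · rw [e, zdot_four, zdot_five, zdot_six, zdot_ten]; simp; ring
    · refine fin (zdot 10 y p) (zdot 4 y p) (zdot 7 y p) (zdot 8 y p) a1 a0 b2 b3 ?_ ?_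
      · linarith [pos 0, pos 1, pos 2, pos 3, pos 5, pos 6, pos 9]
      · rw [e, zdot_four, zdot_seven, zdot_eight, zdot_ten]; simp; ring
    · refine fin (zdot 10 y p) (zdot 5 y p) (zdot 7 y p) (zdot 9 y p) a2 a0 a1 b3 ?_ ?_
      · linarith [pos 0, pos 1, pos 2, pos 3, pos 4, pos 6, pos 8]
      · rw [e, zdot_five, zdot_seven, zdot_nine, zdot_ten]; simp; ring
    · refine fin (zdot 10 y p) (zdot 6 y p) (zdot 8 y p) (zdot 9 y p) a3 a0 a1 a2 ?_ ?_
      · linarith [pos 0, pos 1, pos 2, pos 3, pos 4, pos 5, pos 7]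
      · rw [e, zdot_six, zdot_eight, zdot_nine, zdot_ten]; simp; ring
  rcases hs0.eq_or_lt with h | h
  · have h4 : rad y = 0 := by linarith
    have h5 : y 0 = 0 := by linarith
    have : qq y = 0 := by rw [qq, h4, h5, sub_zero]
    rw [this]; simpa using zsum_nonneg y p
  · rw [abs_mul, abs_mul, abs_of_pos h, mul_assoc] at main
    exact le_of_mul_le_mul_left main h

/-- outside the open wedge (or for times `≤ 1`) all derivatives are controlled by the fields -/
lemma mul_abs_le_zsum_of_outside (α : Fin 4) (y p : Fin 4 → ℝ) (hy : 0 ≤ y 0)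
    (h : y 0 ≤ 1 ∨ rad y ≤ y 0 / 2 ∨ 2 * y 0 ≤ rad y) :
    (1 + y 0 + rad y) * |p α| ≤ 6 * zsum y p := by
  have h1 := abs_le_zsum α y p
  have h2 := abs_qq_mul_le_zsum α y p hy
  have hr := rad_nonneg y
  have h0 := abs_nonneg (p α)
  have hq1 : rad y - y 0 ≤ |qq y| := le_abs_self _
  have hq2 : y 0 - rad y ≤ |qq y| := by rw [qq, abs_sub_comm]; exact le_abs_self _
  have : 1 + y 0 + rad y ≤ 3 * (1 + |qq y|) := by
    rcases h with h | h | h <;> linarith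
  calc (1 + y 0 + rad y) * |p α| ≤ 3 * (1 + |qq y|) * |p α| :=
        mul_le_mul_of_nonneg_right this h0
    _ = 3 * |p α| + 3 * (|qq y| * |p α|) := by ring
    _ ≤ 6 * zsum y p := by linarith

lemma uom_sq {y : Fin 4 → ℝ} (hr : 0 < rad y) :
    uom y 0 ^ 2 + uom y 1 ^ 2 + uom y 2 ^ 2 = 1 := by
  have h := rad_sq y
  simp only [uom, sp]
  field_simp
  simpa using h.symm

lemma coord_eq_rad_mul_uom {y : Fin 4 → ℝ} (hr : 0 < rad y) :
    y 1 = rad y * uom y 0 ∧ y 2 = rad y * uom y 1 ∧ y 3 = rad y * uom y 2 := by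
  simp only [uom, sp]
  refine ⟨?_, ?_, ?_⟩ <;> field_simp <;> rfl

lemma abs_uom_le_one {y : Fin 4 → ℝ} (hr : 0 < rad y) (i : Fin 3) : |uom y i| ≤ 1 := by
  have h := uom_sq hr
  apply abs_le_of_sq_le_sq _ zero_le_one
  have h0 := sq_nonneg (uom y 0)
  have h1 := sq_nonneg (uom y 1)
  have h2 := sq_nonneg (uom y 2)
  fin_cases i
  exacts [show uom y 0 ^ 2 ≤ 1 ^ 2 by linarith, show uom y 1 ^ 2 ≤ 1 ^ 2 by linarith,
    show uom y 2 ^ 2 ≤ 1 ^ 2 by linarith]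

lemma tdot_zero (ω : Fin 3 → ℝ) (p : Fin 4 → ℝ) :
    tdot ω 0 p = (p 0 + ω 0 * p 1 + ω 1 * p 2 + ω 2 * p 3) / 2 := by
  simp [tdot, vecLlow, vecLb, Fin.sum_univ_four]; ring

lemma tdot_succ (ω : Fin 3 → ℝ) (i : Fin 3) (p : Fin 4 → ℝ) :
    tdot ω i.succ p = p i.succ - ω i * (ω 0 * p 1 + ω 1 * p 2 + ω 2 * p 3)
      + ω i * tdot ω 0 p := by
  rw [tdot_zero]
  fin_cases i <;> simp [tdot, vecLlow, vecLb, Fin.sum_univ_four] <;> ring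

lemma rad_mul_abs_tdot_zero_le (y p : Fin 4 → ℝ) (hy : 0 ≤ y 0) (hr : 0 < rad y) :
    rad y * |tdot (uom y) 0 p| ≤ zsum y p := by
  obtain ⟨e1, e2, e3⟩ := coord_eq_rad_mul_uom hr
  have hw := abs_uom_le_one hr
  have hs := uom_sq hr
  have e : (y 0 + rad y) * (2 * tdot (uom y) 0 p) = 1 * zdot 10 y p + (-uom y 0) * zdot 4 y p
      + (-uom y 1) * zdot 5 y p + (-uom y 2) * zdot 6 y p := by
    rw [tdot_zero, zdot_four, zdot_five, zdot_six, zdot_ten, e1, e2, e3]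
    linear_combination (- rad y * p 0) * hs
  have h1 : |(y 0 + rad y) * (2 * tdot (uom y) 0 p)| ≤ zsum y p := by
    rw [e]
    refine (abs_lin_comb_le (s := 1) _ _ _ _ (by simp) (by simpa using hw 0)
      (by simpa using hw 1) (by simpa using hw 2)).trans ?_
    have pos : ∀ i, 0 ≤ |zdot i y p| := fun i => abs_nonneg _
    linarith [zsum_eq y p, pos 0, pos 1, pos 2, pos 3, pos 7, pos 8, pos 9]
  rw [abs_mul, abs_mul, abs_of_pos (by positivity : 0 < y 0 + rad y), abs_two] at h1
  have : rad y * |tdot (uom y) 0 p| ≤ (y 0 + rad y) * (2 * |tdot (uom y) 0 p|) := by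
    have := abs_nonneg (tdot (uom y) 0 p)
    nlinarith [mul_nonneg hy this, mul_nonneg hr.le this]
  exact this.trans h1

lemma rad_mul_abs_tdot_le (α : Fin 4) (y p : Fin 4 → ℝ) (hy : 0 ≤ y 0) (hr : 0 < rad y) :
    rad y * |tdot (uom y) α p| ≤ 2 * zsum y p := by
  have h0 := rad_mul_abs_tdot_zero_le y p hy hr
  have hz := zsum_nonneg y p
  refine Fin.cases (by linarith) (fun i => ?_) α
  obtain ⟨e1, e2, e3⟩ := coord_eq_rad_mul_uom hr
  have hw := abs_uom_le_one hr
  have hw' : ∀ i, |-uom y i| ≤ 1 := fun i => by simpa using hw i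
  have hs := uom_sq hr
  have h1 : |rad y * (p i.succ - uom y i * (uom y 0 * p 1 + uom y 1 * p 2 + uom y 2 * p 3))|
      ≤ zsum y p := by
    have fin : ∀ {a b : ℝ} (z w : ℝ), |a| ≤ 1 → |b| ≤ 1 → |z| + |w| ≤ zsum y p →
        rad y * (p i.succ - uom y i * (uom y 0 * p 1 + uom y 1 * p 2 + uom y 2 * p 3))
          = a * z + b * w →
        |rad y * (p i.succ - uom y i * (uom y 0 * p 1 + uom y 1 * p 2 + uom y 2 * p 3))|
          ≤ zsum y p := fun z w ha hb hz he => by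
      have := abs_lin_comb_le (s := 1) z w 0 0 ha hb (c := 0) (d := 0) (by simp) (by simp)
      rw [he]
      simp at this
      linarith
    have pos : ∀ i, 0 ≤ |zdot i y p| := fun i => abs_nonneg _
    have hz := zsum_eq y p
    fin_cases i
    · refine fin (zdot 7 y p) (zdot 8 y p) (hw' 1) (hw' 2) ?_ ?_
      · linarith [pos 0, pos 1, pos 2, pos 3, pos 4, pos 5, pos 6, pos 9, pos 10]
      · rw [zdot_seven, zdot_eight, e1, e2, e3]; simp
        linear_combination (- rad y * p 1) * hs
    · refine fin (zdot 7 y p) (zdot 9 y p) (hw 0) (hw' 2) ?_ ?_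
      · linarith [pos 0, pos 1, pos 2, pos 3, pos 4, pos 5, pos 6, pos 8, pos 10]
      · rw [zdot_seven, zdot_nine, e1, e2, e3]; simp
        linear_combination (- rad y * p 2) * hs
    · refine fin (zdot 8 y p) (zdot 9 y p) (hw 0) (hw 1) ?_ ?_
      · linarith [pos 0, pos 1, pos 2, pos 3, pos 4, pos 5, pos 6, pos 7, pos 10]
      · rw [zdot_eight, zdot_nine, e1, e2, e3]; simp
        linear_combination (- rad y * p 3) * hs
  rw [tdot_succ]
  calc rad y * |p i.succ - uom y i * (uom y 0 * p 1 + uom y 1 * p 2 + uom y 2 * p 3)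
        + uom y i * tdot (uom y) 0 p|
      ≤ rad y * (|p i.succ - uom y i * (uom y 0 * p 1 + uom y 1 * p 2 + uom y 2 * p 3)|
        + |uom y i| * |tdot (uom y) 0 p|) := by
        rw [← abs_mul]; exact mul_le_mul_of_nonneg_left (abs_add_le _ _) hr.le
    _ = |rad y * (p i.succ - uom y i * (uom y 0 * p 1 + uom y 1 * p 2 + uom y 2 * p 3))|
        + |uom y i| * (rad y * |tdot (uom y) 0 p|) := by
        rw [abs_mul (rad y), abs_of_pos hr]; ring
    _ ≤ zsum y p + 1 * (rad y * |tdot (uom y) 0 p|) :=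
        add_le_add h1 (mul_le_mul_of_nonneg_right (hw i) (by positivity))
    _ ≤ 2 * zsum y p := by linarith

lemma abs_vecLlow_le {y : Fin 4 → ℝ} (hr : 0 < rad y) (α : Fin 4) :
    |vecLlow (uom y) α| ≤ 1 := by
  have hw := abs_uom_le_one hr
  fin_cases α <;> simp [vecLlow, hw]

lemma abs_vecLb_le {y : Fin 4 → ℝ} (hr : 0 < rad y) (α : Fin 4) :
    |vecLb (uom y) α| ≤ 1 := by
  have hw := abs_uom_le_one hr
  fin_cases α <;> simp [vecLb, hw]

lemma abs_sum_mul_le {n : ℕ} (a p : Fin n → ℝ) (h : ∀ i, |a i| ≤ 1) :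
    |∑ i, a i * p i| ≤ ∑ i, |p i| := by
  refine (Finset.abs_sum_le_sum_abs _ _).trans (Finset.sum_le_sum fun i _ => ?_)
  rw [abs_mul]
  nlinarith [abs_nonneg (p i), h i]

lemma abs_tdot_le_sum (α : Fin 4) (y p : Fin 4 → ℝ) (hr : 0 < rad y) :
    |tdot (uom y) α p| ≤ 2 * ∑ μ, |p μ| := by
  have h1 := abs_sum_mul_le _ p (abs_vecLb_le hr)
  have h2 : |p α| ≤ ∑ μ, |p μ| :=
    Finset.single_le_sum (f := fun i => |p i|) (fun _ _ => abs_nonneg _) (Finset.mem_univ α)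
  have h3 := abs_vecLlow_le hr α
  unfold tdot
  refine (abs_add_le _ _).trans ?_
  rw [abs_div, abs_mul, abs_two]
  have h4 := mul_le_mul h3 h1 (abs_nonneg _) zero_le_one
  have h5 := abs_nonneg (vecLlow (uom y) α * ∑ μ, vecLb (uom y) μ * p μ)
  have h6 := abs_nonneg (p α)
  linarith

/-- a covector is controlled by its `L̄` component and the fields -/
lemma rad_mul_abs_le (α : Fin 4) (y p : Fin 4 → ℝ) (hy : 0 ≤ y 0) (hr : 0 < rad y) :
    rad y * |p α| ≤ |rad y * ∑ μ, vecLb (uom y) μ * p μ| + 2 * zsum y p := by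
  have h1 := rad_mul_abs_tdot_le α y p hy hr
  have h3 := abs_vecLlow_le hr α
  set b := ∑ μ, vecLb (uom y) μ * p μ with hb
  have e : rad y * p α = rad y * tdot (uom y) α p - vecLlow (uom y) α * (rad y * b) / 2 := by
    simp only [tdot, ← hb]; ring
  rw [← abs_of_pos hr, ← abs_mul, abs_of_pos hr, e]
  refine (abs_sub _ _).trans ?_
  rw [abs_div, abs_mul, abs_mul (vecLlow _ _), abs_two, abs_of_pos hr]
  have h4 := mul_le_mul_of_nonneg_right h3 (abs_nonneg (rad y * b))
  have h5 := abs_nonneg (rad y * b)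
  linarith

/-- the constant matrix `∂_α Z_i^μ` -/
def zmat (i : Fin 11) (α μ : Fin 4) : ℝ := ZV i (Pi.single α 1) μ - ZV i 0 μ

lemma ZV_affine (i : Fin 11) (y v : Fin 4 → ℝ) (μ : Fin 4) :
    ZV i (y + v) μ = ZV i y μ + ∑ α, zmat i α μ * v α := by
  fin_cases i <;> fin_cases μ <;>
    simp [zmat, ZV, dVF, omVF, sVF, lowerc, Fin.sum_univ_four] <;> ring

lemma abs_zmat_le (i : Fin 11) (α μ : Fin 4) : |zmat i α μ| ≤ 1 := by
  fin_cases i <;> fin_cases μ <;> fin_cases α <;>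
    simp [zmat, ZV, dVF, omVF, sVF, lowerc]

lemma tdot_zdot_comm (ω : Fin 3 → ℝ) (β : Fin 4) (i : Fin 11) (y : Fin 4 → ℝ)
    (h : Fin 4 → Fin 4 → ℝ) :
    zdot i y (fun μ => tdot ω β (h μ)) = tdot ω β (fun ν => zdot i y (fun μ => h μ ν)) := by
  simp only [zdot, tdot, Fin.sum_univ_four]; ring

lemma tdot_sub (ω : Fin 3 → ℝ) (β : Fin 4) (p q : Fin 4 → ℝ) :
    tdot ω β (fun ν => p ν - q ν) = tdot ω β p - tdot ω β q := by
  simp only [tdot, Fin.sum_univ_four]; ring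

/-- two tangential contractions of a Hessian gain two powers of `r` -/
lemma rad_mul_abs_tdot_tdot_le (α β : Fin 4) (y p : Fin 4 → ℝ) (hy : 0 ≤ y 0) (hr : 0 < rad y)
    (h : Fin 4 → Fin 4 → ℝ) (d : Fin 11 → Fin 4 → ℝ)
    (hd : ∀ i ν, zdot i y (fun μ => h μ ν) = d i ν - ∑ μ, zmat i ν μ * p μ) :
    rad y * |tdot (uom y) α (fun μ => tdot (uom y) β (h μ))|
      ≤ 4 * (rad y)⁻¹ * (∑ i, zsum y (d i)) + 176 * ∑ μ, |p μ| := by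
  refine (rad_mul_abs_tdot_le α y _ hy hr).trans ?_
  have key : ∀ i, |zdot i y (fun μ => tdot (uom y) β (h μ))|
      ≤ 2 * (rad y)⁻¹ * zsum y (d i) + 8 * ∑ μ, |p μ| := fun i => by
    rw [tdot_zdot_comm]
    simp only [hd]
    rw [tdot_sub]
    refine (abs_sub _ _).trans (add_le_add ?_ ?_)
    · have := rad_mul_abs_tdot_le β y (d i) hy hr
      rw [mul_comm 2, mul_assoc, ← div_eq_inv_mul, le_div_iff₀ hr]
      linarith
    · refine (abs_tdot_le_sum β y _ hr).trans ?_
      have : ∀ ν ∈ (Finset.univ : Finset (Fin 4)),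
          |∑ μ, zmat i ν μ * p μ| ≤ ∑ μ, |p μ| := fun ν _ =>
        abs_sum_mul_le _ _ (abs_zmat_le i ν)
      have := Finset.sum_le_sum this
      rw [Finset.sum_const, Finset.card_univ, Fintype.card_fin, nsmul_eq_mul] at this
      push_cast at this
      linarith
  have := Finset.sum_le_sum fun i (_ : i ∈ (Finset.univ : Finset (Fin 11))) => key i
  rw [Finset.sum_add_distrib, ← Finset.mul_sum, Finset.sum_const, Finset.card_univ,
    Fintype.card_fin, nsmul_eq_mul] at this
  push_cast at this
  unfold zsum at this ⊢
  linarith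

lemma zsum_hess_le (y p : Fin 4 → ℝ) (h : Fin 4 → Fin 4 → ℝ) (d : Fin 11 → Fin 4 → ℝ)
    (hd : ∀ i ν, zdot i y (fun μ => h μ ν) = d i ν - ∑ μ, zmat i ν μ * p μ) (ν : Fin 4) :
    zsum y (fun μ => h μ ν) ≤ (∑ i, |d i ν|) + 11 * ∑ μ, |p μ| := by
  have key : ∀ i, |zdot i y (fun μ => h μ ν)| ≤ |d i ν| + ∑ μ, |p μ| := fun i => by
    rw [hd]
    exact (abs_sub _ _).trans (add_le_add le_rfl (abs_sum_mul_le _ _ (abs_zmat_le i ν)))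
  have := Finset.sum_le_sum fun i (_ : i ∈ (Finset.univ : Finset (Fin 11))) => key i
  rw [Finset.sum_add_distrib, Finset.sum_const, Finset.card_univ,
    Fintype.card_fin, nsmul_eq_mul] at this
  push_cast at this
  exact this

/-- the perturbation of the transport direction produced by the tensor `H` -/
def xpert (H : Fin 4 → Fin 4 → ℝ) (ω : Fin 3 → ℝ) (ν : Fin 4) : ℝ :=
  (∑ α, H α ν * vecLlow ω α) + con2 H (vecLlow ω) (vecLlow ω) * vecLb ω ν / 4

/-- the transport direction `g^{αν} L_α + ¼ H_{LL} L̄^ν` -/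
def xdir (H : Fin 4 → Fin 4 → ℝ) (ω : Fin 3 → ℝ) (ν : Fin 4) : ℝ := vecL ω ν + xpert H ω ν

lemma hess_contraction (H h : Fin 4 → Fin 4 → ℝ) (ω : Fin 3 → ℝ)
    (hH : ∀ α β, H α β = H β α) (hh : ∀ α β, h α β = h β α) :
    (∑ ν, xpert H ω ν * ∑ μ, vecLb ω μ * h ν μ) + ∑ α, ∑ β, H α β * h α β
      = ∑ α, ∑ β, H α β * tdot ω α (fun μ => tdot ω β (h μ)) := by
  have h10 := hh 1 0
  have h20 := hh 2 0
  have h30 := hh 3 0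
  have h21 := hh 2 1
  have h31 := hh 3 1
  have h32 := hh 3 2
  have H10 := hH 1 0
  have H20 := hH 2 0
  have H30 := hH 3 0
  have H21 := hH 2 1
  have H31 := hH 3 1
  have H32 := hH 3 2
  simp only [xpert, con2, tdot, Fin.sum_univ_four]
  rw [h10, h20, h30, h21, h31, h32, H10, H20, H30, H21, H31, H32]
  ring

lemma minkowski_contraction (y p : Fin 4 → ℝ) (hr : 0 < rad y)
    (h : Fin 4 → Fin 4 → ℝ) (hh : ∀ α β, h α β = h β α) (d : Fin 11 → Fin 4 → ℝ)
    (hd : ∀ i ν, zdot i y (fun μ => h μ ν) = d i ν - ∑ μ, zmat i ν μ * p μ) :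
    (p 0 - (uom y 0 * p 1 + uom y 1 * p 2 + uom y 2 * p 3))
      + rad y * (∑ ν, vecL (uom y) ν * ∑ μ, vecLb (uom y) μ * h ν μ)
      + rad y * (∑ α, ∑ β, mink α β * h α β)
    = 2 * tdot (uom y) 0 p
      + (rad y)⁻¹ * (zdot 7 y (d 7) + zdot 8 y (d 8) + zdot 9 y (d 9)) := by
  have hd' : ∀ i ν, d i ν = zdot i y (fun μ => h μ ν) + ∑ μ, zmat i ν μ * p μ := fun i ν => by
    rw [hd]; ring
  obtain ⟨e1, e2, e3⟩ := coord_eq_rad_mul_uom hr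
  have hs := uom_sq hr
  have h10 := hh 1 0
  have h20 := hh 2 0
  have h30 := hh 3 0
  have h21 := hh 2 1
  have h31 := hh 3 1
  have h32 := hh 3 2
  rw [tdot_zero, zdot_seven, zdot_eight, zdot_nine]
  simp only [hd', zdot_seven, zdot_eight, zdot_nine]
  simp only [zmat, ZV, vecL, vecLb, mink, Fin.sum_univ_four, e1, e2, e3]
  simp [omVF, lowerc, h10, h20, h30, h21, h31, h32]
  field_simp
  linear_combination (- rad y * (h 1 1 + h 2 2 + h 3 3)) * hs

lemma abs_sum_mul_le_of_le {n : ℕ} {η : ℝ} (a p : Fin n → ℝ) (h : ∀ i, |a i| ≤ η) :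
    |∑ i, a i * p i| ≤ η * ∑ i, |p i| := by
  rw [Finset.mul_sum]
  refine (Finset.abs_sum_le_sum_abs _ _).trans (Finset.sum_le_sum fun i _ => ?_)
  rw [abs_mul]
  exact mul_le_mul_of_nonneg_right (h i) (abs_nonneg _)

lemma abs_con2_le {η : ℝ} (H : Fin 4 → Fin 4 → ℝ) (hb : ∀ α β, |H α β| ≤ η)
    (U V : Fin 4 → ℝ) (hU : ∀ α, |U α| ≤ 1) (hV : ∀ α, |V α| ≤ 1) : |con2 H U V| ≤ 16 * η := by
  have h : ∀ α β, |H α β * U α * V β| ≤ η := fun α β => by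
    rw [abs_mul, abs_mul]
    have h1 := hb α β
    have h0 := abs_nonneg (H α β)
    calc |H α β| * |U α| * |V β| ≤ |H α β| * 1 * 1 := by
          gcongr
          · exact hU α
          · exact hV β
      _ ≤ η := by simpa using h1
  unfold con2
  refine (Finset.abs_sum_le_sum_abs _ _).trans ?_
  refine (Finset.sum_le_sum fun α _ => (Finset.abs_sum_le_sum_abs _ _).trans
    (Finset.sum_le_sum fun β _ => h α β)).trans ?_
  simp
  linarith

lemma abs_xpert_le {η : ℝ} {y : Fin 4 → ℝ} (hr : 0 < rad y) (H : Fin 4 → Fin 4 → ℝ)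
    (hb : ∀ α β, |H α β| ≤ η) (ν : Fin 4) : |xpert H (uom y) ν| ≤ 8 * η := by
  have h1 := abs_con2_le H hb _ _ (abs_vecLlow_le hr) (abs_vecLlow_le hr)
  have h2 := abs_sum_mul_le_of_le (fun α => H α ν) (vecLlow (uom y)) (fun α => hb α ν)
  have h3 : ∑ α, |vecLlow (uom y) α| ≤ 4 := by
    have := Finset.sum_le_sum fun α (_ : α ∈ (Finset.univ : Finset (Fin 4))) =>
      abs_vecLlow_le hr α
    simpa using this
  have hη : 0 ≤ η := (abs_nonneg _).trans (hb 0 0)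
  have h4 := abs_vecLb_le hr ν
  unfold xpert
  refine (abs_add_le _ _).trans ?_
  rw [abs_div, abs_mul, abs_of_pos (by norm_num : (0:ℝ) < 4)]
  have h5 := mul_le_mul h1 h4 (abs_nonneg _) (by positivity)
  have h6 := mul_le_mul_of_nonneg_left h3 hη
  linarith

/-- `X` applied to `r ∂_tψ - x^i ∂_iψ`, where `p`, `h` are the first and second derivatives -/
def xu (H h : Fin 4 → Fin 4 → ℝ) (y p : Fin 4 → ℝ) : ℝ :=
  (∑ i : Fin 3, uom y i * xdir H (uom y) i.succ) * p 0
    - (∑ i : Fin 3, xdir H (uom y) i.succ * p i.succ)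
    + rad y * ∑ ν, xdir H (uom y) ν * ∑ μ, vecLb (uom y) μ * h ν μ

lemma transport_bound {η : ℝ} (y p : Fin 4 → ℝ) (hy : 0 ≤ y 0) (hr : 0 < rad y)
    (H h : Fin 4 → Fin 4 → ℝ) (hH : ∀ α β, H α β = H β α) (hh : ∀ α β, h α β = h β α)
    (hη : η ≤ 1 / 4) (hb : ∀ α β, |H α β| ≤ η) (d : Fin 11 → Fin 4 → ℝ)
    (hd : ∀ i ν, zdot i y (fun μ => h μ ν) = d i ν - ∑ μ, zmat i ν μ * p μ) :
    |xu H h y p + rad y * ((∑ α, ∑ β, mink α β * h α β) + ∑ α, ∑ β, H α β * h α β)|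
      ≤ 20 * (rad y)⁻¹ * (zsum y p + ∑ i, zsum y (d i)) + 3000 * η * ∑ μ, |p μ| := by
  have hη0 : 0 ≤ η := (abs_nonneg _).trans (hb 0 0)
  have hm := minkowski_contraction y p hr h hh d hd
  have hc := hess_contraction H h (uom y) hH hh
  have hs := uom_sq hr
  have e : xu H h y p + rad y * ((∑ α, ∑ β, mink α β * h α β) + ∑ α, ∑ β, H α β * h α β)
      = 2 * tdot (uom y) 0 p
      + (rad y)⁻¹ * (zdot 7 y (d 7) + zdot 8 y (d 8) + zdot 9 y (d 9))
      + ((∑ i : Fin 3, uom y i * xpert H (uom y) i.succ) * p 0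
        - (∑ i : Fin 3, xpert H (uom y) i.succ * p i.succ)
        + rad y * ∑ α, ∑ β, H α β * tdot (uom y) α (fun μ => tdot (uom y) β (h μ))) := by
    rw [← hm, ← hc]
    simp only [xu, xdir, add_mul, mul_add, Finset.sum_add_distrib]
    have f1 : ∑ i : Fin 3, uom y i * vecL (uom y) i.succ = 1 := by
      rw [← hs]; simp [Fin.sum_univ_three, vecL]; ring
    have f2 : ∑ i : Fin 3, vecL (uom y) i.succ * p i.succ
        = uom y 0 * p 1 + uom y 1 * p 2 + uom y 2 * p 3 := by
      simp [Fin.sum_univ_three, vecL]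
    rw [f1, f2]; ring
  rw [e]
  have b1 := rad_mul_abs_tdot_zero_le y p hy hr
  have b1' : |tdot (uom y) 0 p| ≤ (rad y)⁻¹ * zsum y p := by
    rw [← div_eq_inv_mul, le_div_iff₀ hr]; linarith
  have b2 : |zdot 7 y (d 7) + zdot 8 y (d 8) + zdot 9 y (d 9)| ≤ ∑ i, zsum y (d i) := by
    refine (abs_add_three _ _ _).trans ?_
    have h7 := abs_zdot_le 7 y (d 7)
    have h8 := abs_zdot_le 8 y (d 8)
    have h9 := abs_zdot_le 9 y (d 9)
    have : zsum y (d 7) + zsum y (d 8) + zsum y (d 9) ≤ ∑ i, zsum y (d i) := by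
      have := Finset.sum_le_univ_sum_of_nonneg (f := fun i => zsum y (d i))
        (fun i => zsum_nonneg y (d i)) (s := {7, 8, 9})
      rw [Finset.sum_insert (by decide), Finset.sum_insert (by decide),
        Finset.sum_singleton] at this
      linarith
    linarith
  have hx := abs_xpert_le hr H hb
  set P := ∑ μ, |p μ| with hP
  have hPe : P = |p 0| + ∑ i : Fin 3, |p i.succ| := Fin.sum_univ_succ _
  have b3 : |(∑ i : Fin 3, uom y i * xpert H (uom y) i.succ) * p 0| ≤ 24 * η * |p 0| := by
    rw [abs_mul]
    refine mul_le_mul_of_nonneg_right ?_ (abs_nonneg _)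
    refine (abs_sum_mul_le _ _ (abs_uom_le_one hr)).trans ?_
    have := Finset.sum_le_sum fun i (_ : i ∈ (Finset.univ : Finset (Fin 3))) => hx i.succ
    simp at this ⊢
    linarith
  have b4 : |∑ i : Fin 3, xpert H (uom y) i.succ * p i.succ|
      ≤ 8 * η * ∑ i : Fin 3, |p i.succ| := abs_sum_mul_le_of_le _ _ fun i => hx i.succ
  set D := ∑ i, zsum y (d i) with hD
  have hD0 : 0 ≤ D := Finset.sum_nonneg fun i _ => zsum_nonneg y (d i)
  have b5 : |rad y * ∑ α, ∑ β, H α β * tdot (uom y) α (fun μ => tdot (uom y) β (h μ))|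
      ≤ 16 * η * (4 * (rad y)⁻¹ * D + 176 * P) := by
    have h1 : ∀ α β, |rad y * (H α β * tdot (uom y) α (fun μ => tdot (uom y) β (h μ)))|
        ≤ η * (4 * (rad y)⁻¹ * D + 176 * P) := fun α β => by
      have := rad_mul_abs_tdot_tdot_le α β y p hy hr h d hd
      rw [abs_mul, abs_mul, abs_of_pos hr, mul_left_comm]
      exact mul_le_mul (hb α β) this (by positivity) hη0
    rw [Finset.mul_sum]
    simp only [Finset.mul_sum]
    refine (Finset.abs_sum_le_sum_abs _ _).trans ?_
    refine (Finset.sum_le_sum fun α _ => (Finset.abs_sum_le_sum_abs _ _).trans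
      (Finset.sum_le_sum fun β _ => h1 α β)).trans ?_
    simp
    linarith
  have hri : 0 < (rad y)⁻¹ := by positivity
  have hP0 : 0 ≤ P := Finset.sum_nonneg fun _ _ => abs_nonneg _
  have b2' := mul_le_mul_of_nonneg_left b2 hri.le
  have hz := zsum_nonneg y p
  have s0 : 0 ≤ ∑ i : Fin 3, |p i.succ| := Finset.sum_nonneg fun _ _ => abs_nonneg _
  refine (abs_add_le _ _).trans ?_
  refine (add_le_add (abs_add_le _ _) (abs_add_le _ _)).trans ?_
  refine (add_le_add_right (add_le_add_left (abs_sub _ _) _) _).trans ?_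
  rw [abs_mul 2, abs_mul (rad y)⁻¹, abs_of_pos hri, abs_two]
  have c1 : η * ((rad y)⁻¹ * D) ≤ 1 / 4 * ((rad y)⁻¹ * D) :=
    mul_le_mul_of_nonneg_right hη (by positivity)
  have c2 : 0 ≤ (rad y)⁻¹ * zsum y p := by positivity
  have c3 : 0 ≤ (rad y)⁻¹ * D := by positivity
  have c4 : 0 ≤ η * P := by positivity
  have c5 : 0 ≤ η * ∑ i : Fin 3, |p i.succ| := by positivity
  have c6 : η * P = η * |p 0| + η * ∑ i : Fin 3, |p i.succ| := by rw [hPe]; ring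
  nlinarith

lemma tnorm_sq (p : Fin 4 → Fin 4 → ℝ) : tnorm p ^ 2 = ∑ α, ∑ β, p α β ^ 2 :=
  Real.sq_sqrt (Finset.sum_nonneg fun _ _ => Finset.sum_nonneg fun _ _ => sq_nonneg _)

lemma tnorm_nonneg (p : Fin 4 → Fin 4 → ℝ) : 0 ≤ tnorm p := Real.sqrt_nonneg _

lemma abs_le_tnorm (p : Fin 4 → Fin 4 → ℝ) (α β : Fin 4) : |p α β| ≤ tnorm p := by
  apply abs_le_of_sq_le_sq _ (tnorm_nonneg p)
  rw [tnorm_sq]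
  refine (Finset.single_le_sum (f := fun β => p α β ^ 2) (fun _ _ => sq_nonneg _)
    (Finset.mem_univ β)).trans ?_
  exact Finset.single_le_sum (f := fun α => ∑ β, p α β ^ 2)
    (fun _ _ => Finset.sum_nonneg fun _ _ => sq_nonneg _) (Finset.mem_univ α)

/-- the transport direction is future directed when the perturbation is small -/
lemma half_le_xdir_zero {y : Fin 4 → ℝ} (hr : 0 < rad y) (H : Fin 4 → Fin 4 → ℝ)
    (hb : tnorm H ≤ 1 / 4) : 1 / 2 ≤ xdir H (uom y) 0 := by
  have hs := uom_sq hr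
  set L := vecLlow (uom y) with hL
  have hL2 : ∑ α, L α ^ 2 = 2 := by
    rw [hL]; simp [vecLlow, Fin.sum_univ_four]; linarith
  have hT : ∑ α, ∑ β, H α β ^ 2 ≤ 1 / 16 := by
    rw [← tnorm_sq]; nlinarith [tnorm_nonneg H]
  have h1 : |∑ α, H α 0 * L α| ≤ 3 / 8 := by
    apply abs_le_of_sq_le_sq _ (by norm_num)
    have := Finset.sum_mul_sq_le_sq_mul_sq Finset.univ (fun α => H α 0) L
    have h2 : ∑ α, H α 0 ^ 2 ≤ ∑ α, ∑ β, H α β ^ 2 :=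
      Finset.sum_le_sum fun α _ => Finset.single_le_sum (f := fun β => H α β ^ 2)
        (fun _ _ => sq_nonneg _) (Finset.mem_univ 0)
    rw [hL2] at this
    linarith
  have h2 : |con2 H L L| ≤ 1 / 2 := by
    apply abs_le_of_sq_le_sq _ (by norm_num)
    have e : con2 H L L = ∑ α, (∑ β, H α β * L β) * L α := by
      unfold con2
      refine Finset.sum_congr rfl fun α _ => ?_
      rw [Finset.sum_mul]
      exact Finset.sum_congr rfl fun β _ => by ring
    rw [e]
    have := Finset.sum_mul_sq_le_sq_mul_sq Finset.univ (fun α => ∑ β, H α β * L β) L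
    have h3 : ∑ α, (∑ β, H α β * L β) ^ 2 ≤ ∑ α, (∑ β, H α β ^ 2) * 2 :=
      Finset.sum_le_sum fun α _ => by
        rw [← hL2]; exact Finset.sum_mul_sq_le_sq_mul_sq Finset.univ (H α) L
    rw [← Finset.sum_mul] at h3
    rw [hL2] at this
    linarith
  have h4 : xdir H (uom y) 0 = 1 + (∑ α, H α 0 * L α + con2 H L L / 4) := by
    simp [xdir, xpert, vecL, vecLb, hL]
  rw [h4]
  linarith [neg_abs_le (∑ α, H α 0 * L α), neg_abs_le (con2 H L L)]

lemma exists_frame (ω : Fin 3 → ℝ) (hω : ω 0 ^ 2 + ω 1 ^ 2 + ω 2 ^ 2 = 1) :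
    ∃ s₁ s₂, IsFrame ω s₁ s₂ := by
  have hs : ∃ s : Fin 3 → ℝ, s 0 ^ 2 + s 1 ^ 2 + s 2 ^ 2 = 1 ∧
      ω 0 * s 0 + ω 1 * s 1 + ω 2 * s 2 = 0 := by
    by_cases h : ω 0 ^ 2 + ω 1 ^ 2 = 0
    · have h0 : ω 0 = 0 := by nlinarith [sq_nonneg (ω 0), sq_nonneg (ω 1)]
      exact ⟨![1, 0, 0], by simp, by simp [h0]⟩
    · have hp : 0 < ω 0 ^ 2 + ω 1 ^ 2 := lt_of_le_of_ne (by positivity) (Ne.symm h)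
      set n := Real.sqrt (ω 0 ^ 2 + ω 1 ^ 2) with hn
      have hn0 : 0 < n := Real.sqrt_pos.2 hp
      have hn2 : n ^ 2 = ω 0 ^ 2 + ω 1 ^ 2 := Real.sq_sqrt hp.le
      refine ⟨![-(ω 1) / n, ω 0 / n, 0], ?_, ?_⟩
      · simp
        field_simp
        linarith
      · simp
        field_simp
        ring
  obtain ⟨s, h1, h2⟩ := hs
  refine ⟨s, ![ω 1 * s 2 - ω 2 * s 1, ω 2 * s 0 - ω 0 * s 2, ω 0 * s 1 - ω 1 * s 0], ?_⟩
  simp only [IsFrame, Fin.sum_univ_three]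
  refine ⟨by linarith, by linarith, ?_, ?_, by linarith, ?_⟩
  · simp
    linear_combination (ω 0 ^ 2 + ω 1 ^ 2 + ω 2 ^ 2) * h1 + hω
      - (ω 0 * s 0 + ω 1 * s 1 + ω 2 * s 2) * h2
  · simp; ring
  · simp; ring

lemma IsFrame.complete {ω s₁ s₂ : Fin 3 → ℝ} (h : IsFrame ω s₁ s₂) (i j : Fin 3) :
    ω i * ω j + s₁ i * s₁ j + s₂ i * s₂ j = if i = j then 1 else 0 := by
  obtain ⟨h1, h2, h3, h4, h5, h6⟩ := h
  set A : Matrix (Fin 3) (Fin 3) ℝ := Matrix.of ![ω, s₁, s₂] with hA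
  have hAA : A * A.transpose = 1 := by
    simp only [Fin.sum_univ_three] at h1 h2 h3 h4 h5 h6
    ext a b
    fin_cases a <;> fin_cases b <;>
      simp [hA, Matrix.mul_apply, Fin.sum_univ_three] <;> linarith
  have hAA' : A.transpose * A = 1 := mul_eq_one_comm.1 hAA
  have := congrFun (congrFun hAA' i) j
  simpa [hA, Matrix.mul_apply, Fin.sum_univ_three, Matrix.one_apply] using this

/-- the contraction with `L` and the part of `e_i` orthogonal to `ω` -/
lemma abs_con2_orth_le {ω : Fin 3 → ℝ}
    (H : Fin 4 → Fin 4 → ℝ) {s₁ s₂ : Fin 3 → ℝ} (h : IsFrame ω s₁ s₂) (i : Fin 3) :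
    |con2 H (vecLlow ω) (spat fun j => (if i = j then 1 else 0) - ω i * ω j)|
      ≤ |con2 H (vecLlow ω) (spat s₁)| + |con2 H (vecLlow ω) (spat s₂)| := by
  have e : (fun j => (if i = j then (1:ℝ) else 0) - ω i * ω j)
      = fun j => s₁ i * s₁ j + s₂ i * s₂ j := by
    funext j; rw [← h.complete i j]; ring
  have e2 : con2 H (vecLlow ω) (spat fun j => s₁ i * s₁ j + s₂ i * s₂ j)
      = s₁ i * con2 H (vecLlow ω) (spat s₁) + s₂ i * con2 H (vecLlow ω) (spat s₂) := by
    simp [con2, spat, Fin.sum_univ_four]; ring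
  have hc := h.complete i i
  simp only [if_true] at hc
  have b1 : |s₁ i| ≤ 1 := abs_le_of_sq_le_sq
    (by nlinarith [mul_self_nonneg (ω i), mul_self_nonneg (s₂ i)]) zero_le_one
  have b2 : |s₂ i| ≤ 1 := abs_le_of_sq_le_sq
    (by nlinarith [mul_self_nonneg (ω i), mul_self_nonneg (s₁ i)]) zero_le_one
  rw [e, e2]
  refine (abs_add_le _ _).trans ?_
  rw [abs_mul, abs_mul]
  have := mul_le_mul_of_nonneg_right b1 (abs_nonneg (con2 H (vecLlow ω) (spat s₁)))
  have := mul_le_mul_of_nonneg_right b2 (abs_nonneg (con2 H (vecLlow ω) (spat s₂)))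
  linarith

/-- the tensor `K` in `g^{αβ}∂_α∂_β Z_iφ = Z_iF + 2 δ_{iS} F + K^{αβ}∂_α∂_βφ`,
where `Q` stands for `Z_i H` -/
def ktens (i : Fin 11) (H Q : Fin 4 → Fin 4 → ℝ) (α β : Fin 4) : ℝ :=
  -Q α β + 2 * (∑ γ, H γ β * zmat i γ α) - (if i = 10 then 2 else 0) * H α β

lemma abs_ktens_le {η : ℝ} (i : Fin 11) (H Q : Fin 4 → Fin 4 → ℝ)
    (hb : ∀ α β, |H α β| ≤ η) (hQ : ∀ α β, |Q α β| ≤ η) (α β : Fin 4) :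
    |ktens i H Q α β| ≤ 11 * η := by
  have h1 : |∑ γ, H γ β * zmat i γ α| ≤ 4 * η := by
    have hη : 0 ≤ η := (abs_nonneg _).trans (hb 0 0)
    refine (abs_sum_mul_le_of_le _ _ fun γ => hb γ β).trans ?_
    have := Finset.sum_le_sum fun γ (_ : γ ∈ (Finset.univ : Finset (Fin 4))) => abs_zmat_le i γ α
    simp at this
    nlinarith
  have h2 : |(if i = 10 then (2:ℝ) else 0) * H α β| ≤ 2 * η := by
    have := hb α β
    have h0 := abs_nonneg (H α β)
    split_ifs
    · rw [abs_mul, abs_two]; linarith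
    · simp; linarith
  unfold ktens
  refine (abs_sub _ _).trans ?_
  refine (add_le_add (abs_add_le _ _) h2).trans ?_
  rw [abs_neg, abs_mul, abs_two]
  linarith [hQ α β]

lemma con2_ktens (i : Fin 11) (H Q : Fin 4 → Fin 4 → ℝ) (L : Fin 4 → ℝ)
    (hH : ∀ α β, H α β = H β α) :
    con2 (ktens i H Q) L L = - con2 Q L L + 2 * con2 H L (fun γ => ∑ α, zmat i γ α * L α)
      - (if i = 10 then 2 else 0) * con2 H L L := by
  have h10 := hH 1 0
  have h20 := hH 2 0
  have h30 := hH 3 0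
  have h21 := hH 2 1
  have h31 := hH 3 1
  have h32 := hH 3 2
  simp only [con2, ktens, Fin.sum_univ_four, h10, h20, h30, h21, h31, h32]
  ring

lemma abs_con2_ktens_le {κ : ℝ} {y : Fin 4 → ℝ} (hr : 0 < rad y) (i : Fin 11)
    (H Q : Fin 4 → Fin 4 → ℝ) (hH : ∀ α β, H α β = H β α) {s₁ s₂ : Fin 3 → ℝ}
    (hf : IsFrame (uom y) s₁ s₂)
    (hQ : |con2 Q (vecLlow (uom y)) (vecLlow (uom y))| ≤ κ)
    (hLT : normLT H (uom y) s₁ s₂ ≤ κ) :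
    |con2 (ktens i H Q) (vecLlow (uom y)) (vecLlow (uom y))| ≤ 5 * κ := by
  rw [con2_ktens _ _ _ _ hH]
  have hs := uom_sq hr
  have hw := abs_uom_le_one hr
  have ho := abs_con2_orth_le H hf
  set ω := uom y with hω
  set a := con2 H (vecLlow ω) (vecLlow ω) with ha
  set b := fun i => con2 H (vecLlow ω) (spat fun j => (if i = j then 1 else 0) - ω i * ω j) with hbd
  have hn : ∀ i, |a| + |b i| ≤ κ := fun i => by
    have := ho i
    unfold normLT at hLT
    linarith
  have hκ : 0 ≤ κ := (abs_nonneg _).trans hQ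
  have fin : ∀ W c : ℝ, |2 * W - c * a| ≤ 4 * κ →
      |-con2 Q (vecLlow ω) (vecLlow ω) + 2 * W - c * a| ≤ 5 * κ := fun W c h => by
    have e : -con2 Q (vecLlow ω) (vecLlow ω) + 2 * W - c * a
      = -con2 Q (vecLlow ω) (vecLlow ω) + (2 * W - c * a) := by ring
    rw [e]
    refine (abs_add_le _ _).trans ?_
    rw [abs_neg]; linarith
  apply fin
  have boost : ∀ j, |2 * (ω j * a + b j) - 0 * a| ≤ 4 * κ := fun j => by
    rw [zero_mul, sub_zero, abs_mul, abs_two]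
    have h1 := abs_add_le (ω j * a) (b j)
    rw [abs_mul] at h1
    have h2 := mul_le_mul_of_nonneg_right (hw j) (abs_nonneg a)
    linarith [hn j]
  have rot : ∀ j k, |2 * (ω j * b k - ω k * b j) - 0 * a| ≤ 4 * κ := fun j k => by
    rw [zero_mul, sub_zero, abs_mul, abs_two]
    have h1 := abs_sub (ω j * b k) (ω k * b j)
    rw [abs_mul, abs_mul] at h1
    have h2 := mul_le_mul_of_nonneg_right (hw j) (abs_nonneg (b k))
    have h3 := mul_le_mul_of_nonneg_right (hw k) (abs_nonneg (b j))
    linarith [hn j, hn k, abs_nonneg a]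
  have lin : ∀ (W : Fin 4 → ℝ) (x : ℝ), con2 H (vecLlow ω) W = x → ∀ c, |2 * x - c * a| ≤ 4 * κ →
    |2 * con2 H (vecLlow ω) W - c * a| ≤ 4 * κ := fun W x e c h => by rw [e]; exact h
  have triv : |2 * 0 - 0 * a| ≤ 4 * κ := by simpa using hκ
  fin_cases i
  · refine lin _ _ ?_ _ triv
    simp [con2, zmat, ZV, dVF]
  · refine lin _ _ ?_ _ triv
    simp [con2, zmat, ZV, dVF]
  · refine lin _ _ ?_ _ triv
    simp [con2, zmat, ZV, dVF]
  · refine lin _ _ ?_ _ triv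
    simp [con2, zmat, ZV, dVF]
  · refine lin _ _ ?_ _ (boost 0)
    simp [a, b, con2, zmat, ZV, omVF, lowerc, spat, vecLlow, Fin.sum_univ_four]; ring
  · refine lin _ _ ?_ _ (boost 1)
    simp [a, b, con2, zmat, ZV, omVF, lowerc, spat, vecLlow, Fin.sum_univ_four]; ring
  · refine lin _ _ ?_ _ (boost 2)
    simp [a, b, con2, zmat, ZV, omVF, lowerc, spat, vecLlow, Fin.sum_univ_four]; ring
  · refine lin _ _ ?_ _ (rot 1 0)
    simp [b, con2, zmat, ZV, omVF, lowerc, spat, vecLlow, Fin.sum_univ_four]; ring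
  · refine lin _ _ ?_ _ (rot 2 0)
    simp [b, con2, zmat, ZV, omVF, lowerc, spat, vecLlow, Fin.sum_univ_four]; ring
  · refine lin _ _ ?_ _ (rot 2 1)
    simp [b, con2, zmat, ZV, omVF, lowerc, spat, vecLlow, Fin.sum_univ_four]; ring
  · have : con2 H (vecLlow ω) (fun γ => ∑ α, zmat 10 γ α * vecLlow ω α) = a := by
      congr 1
      funext γ
      fin_cases γ <;> simp [zmat, ZV, sVF, Pi.single_apply]
    simp only [Fin.reduceFinMk]
    rw [this]
    simpa using hκ

lemma ktens_hess_decomp (K h : Fin 4 → Fin 4 → ℝ) (ω : Fin 3 → ℝ) (hh : ∀ α β, h α β = h β α) :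
    ∑ α, ∑ β, K α β * h α β
      = con2 K (vecLlow ω) (vecLlow ω) * (∑ μ, vecLb ω μ * ∑ ν, vecLb ω ν * h ν μ) / 4
        - (∑ α, ∑ β, K α β * (vecLlow ω α * ∑ μ, vecLb ω μ * tdot ω β (fun ν => h ν μ))) / 2
        + ∑ α, ∑ β, K α β * tdot ω α (fun ν => h ν β) := by
  have h10 := hh 1 0
  have h20 := hh 2 0
  have h30 := hh 3 0
  have h21 := hh 2 1
  have h31 := hh 3 1
  have h32 := hh 3 2
  simp only [con2, tdot, Fin.sum_univ_four, h10, h20, h30, h21, h31, h32]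
  ring

lemma rad_mul_abs_contraction_le {η κ : ℝ} (y : Fin 4 → ℝ) (hy : 0 ≤ y 0) (hr : 0 < rad y)
    (K h : Fin 4 → Fin 4 → ℝ) (hh : ∀ α β, h α β = h β α)
    (hK : ∀ α β, |K α β| ≤ 11 * η)
    (hKL : |con2 K (vecLlow (uom y)) (vecLlow (uom y))| ≤ 5 * κ)
    (hκ : κ ≤ η * (1 + |qq y|) / (1 + y 0 + rad y)) :
    rad y * |∑ α, ∑ β, K α β * h α β| ≤ 300 * η * ∑ μ, zsum y (fun ν => h ν μ) := by
  have hη : 0 ≤ η := by linarith [(abs_nonneg _).trans (hK 0 0)]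
  set Z := ∑ μ, zsum y (fun ν => h ν μ) with hZ
  have hZ0 : 0 ≤ Z := Finset.sum_nonneg fun μ _ => zsum_nonneg y _
  have hL := abs_vecLlow_le hr
  have hLb := abs_vecLb_le hr
  set b := ∑ μ, vecLb (uom y) μ * ∑ ν, vecLb (uom y) ν * h ν μ with hb
  have hb1 : (1 + |qq y|) * |b| ≤ 8 * Z := by
    have h1 : ∀ ν μ, (1 + |qq y|) * |h ν μ| ≤ 2 * zsum y (fun ν => h ν μ) := fun ν μ => by
      have h1 := abs_le_zsum ν y (fun ν => h ν μ)
      have h2 := abs_qq_mul_le_zsum ν y (fun ν => h ν μ) hy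
      linarith
    have h2 : |b| ≤ ∑ μ, ∑ ν, |h ν μ| :=
      (abs_sum_mul_le _ _ hLb).trans (Finset.sum_le_sum fun μ _ => abs_sum_mul_le _ _ hLb)
    calc (1 + |qq y|) * |b| ≤ (1 + |qq y|) * ∑ μ, ∑ ν, |h ν μ| :=
          mul_le_mul_of_nonneg_left h2 (by positivity)
      _ = ∑ μ, ∑ ν, (1 + |qq y|) * |h ν μ| := by simp only [Finset.mul_sum]
      _ ≤ ∑ μ, ∑ ν : Fin 4, 2 * zsum y (fun ν => h ν μ) :=
          Finset.sum_le_sum fun μ _ => Finset.sum_le_sum fun ν _ => h1 ν μ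
      _ = 8 * Z := by
          rw [hZ, Finset.mul_sum]
          refine Finset.sum_congr rfl fun μ _ => ?_
          rw [Finset.sum_const, Finset.card_univ, Fintype.card_fin, nsmul_eq_mul]
          push_cast; ring
  have t1 : rad y * |con2 K (vecLlow (uom y)) (vecLlow (uom y)) * b / 4| ≤ 10 * η * Z := by
    rw [abs_div, abs_mul, abs_of_pos (by norm_num : (0:ℝ) < 4)]
    have hs : 0 < 1 + y 0 + rad y := by positivity
    have h1 : |con2 K (vecLlow (uom y)) (vecLlow (uom y))| * (1 + y 0 + rad y)
        ≤ 5 * η * (1 + |qq y|) := by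
      have := hKL.trans (mul_le_mul_of_nonneg_left hκ (by norm_num))
      have := mul_le_mul_of_nonneg_right this hs.le
      refine this.trans (le_of_eq ?_)
      field_simp
    have h2 : rad y * |con2 K (vecLlow (uom y)) (vecLlow (uom y))| ≤ 5 * η * (1 + |qq y|) := by
      have := abs_nonneg (con2 K (vecLlow (uom y)) (vecLlow (uom y)))
      nlinarith [mul_nonneg this hy]
    have h3 := mul_le_mul_of_nonneg_right h2 (abs_nonneg b)
    have h4 := mul_le_mul_of_nonneg_left hb1 hη
    nlinarith
  have t2 : rad y * |∑ α, ∑ β, K α β * (vecLlow (uom y) α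
      * ∑ μ, vecLb (uom y) μ * tdot (uom y) β (fun ν => h ν μ))| ≤ 352 * η * Z := by
    have h1 : ∀ α β, rad y * |K α β * (vecLlow (uom y) α
        * ∑ μ, vecLb (uom y) μ * tdot (uom y) β (fun ν => h ν μ))| ≤ 22 * η * Z := fun α β => by
      have h2 : rad y * |∑ μ, vecLb (uom y) μ * tdot (uom y) β (fun ν => h ν μ)| ≤ 2 * Z := by
        refine (mul_le_mul_of_nonneg_left (abs_sum_mul_le _ _ hLb) hr.le).trans ?_
        rw [Finset.mul_sum, hZ, Finset.mul_sum]
        exact Finset.sum_le_sum fun μ _ => rad_mul_abs_tdot_le β y _ hy hr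
      rw [abs_mul, abs_mul]
      have h3 := mul_le_mul (hK α β) h2 (by positivity) (by positivity)
      have h4 := mul_le_mul_of_nonneg_left (hL α) (mul_nonneg (abs_nonneg (K α β))
        (mul_nonneg hr.le (abs_nonneg
          (∑ μ, vecLb (uom y) μ * tdot (uom y) β (fun ν => h ν μ)))))
      nlinarith
    refine (mul_le_mul_of_nonneg_left ((Finset.abs_sum_le_sum_abs _ _).trans
      (Finset.sum_le_sum fun α _ => Finset.abs_sum_le_sum_abs _ _)) hr.le).trans ?_
    rw [Finset.mul_sum]
    refine (Finset.sum_le_sum fun α _ => (Finset.mul_sum _ _ _).le.trans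
      (Finset.sum_le_sum fun β _ => h1 α β)).trans ?_
    simp; linarith
  have t3 : rad y * |∑ α, ∑ β, K α β * tdot (uom y) α (fun ν => h ν β)| ≤ 88 * η * Z := by
    have h1 : ∀ α β, rad y * |K α β * tdot (uom y) α (fun ν => h ν β)|
        ≤ 22 * η * zsum y (fun ν => h ν β) := fun α β => by
      rw [abs_mul, mul_left_comm]
      have h3 := mul_le_mul (hK α β) (rad_mul_abs_tdot_le α y (fun ν => h ν β) hy hr)
        (by positivity) (by positivity)
      linarith
    refine (mul_le_mul_of_nonneg_left ((Finset.abs_sum_le_sum_abs _ _).trans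
      (Finset.sum_le_sum fun α _ => Finset.abs_sum_le_sum_abs _ _)) hr.le).trans ?_
    simp only [Finset.mul_sum]
    refine (Finset.sum_le_sum fun α _ => Finset.sum_le_sum fun β _ => h1 α β).trans ?_
    simp only [← Finset.mul_sum, ← hZ]
    simp; linarith
  rw [ktens_hess_decomp K h (uom y) hh, ← hb]
  refine (mul_le_mul_of_nonneg_left ((abs_add_le _ _).trans (add_le_add_left (abs_sub _ _) _))
    hr.le).trans ?_
  rw [mul_add, mul_add, abs_div _ (2:ℝ), abs_two]
  have : 0 ≤ η * Z := by positivity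
  linarith

lemma contDiff_pd {f : (Fin 4 → ℝ) → ℝ} (hf : ContDiff ℝ (⊤ : ℕ∞) f) (α : Fin 4) :
    ContDiff ℝ (⊤ : ℕ∞) (pd f α) :=
  (hf.fderiv_right (m := (⊤ : ℕ∞)) (by simp)).clm_apply contDiff_const

lemma contDiff_differentiable {f : (Fin 4 → ℝ) → ℝ} (hf : ContDiff ℝ (⊤ : ℕ∞) f) :
    Differentiable ℝ f := hf.differentiable (by simp)

lemma contDiff_pd2 {f : (Fin 4 → ℝ) → ℝ} (hf : ContDiff ℝ (⊤ : ℕ∞) f) (α β : Fin 4) :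
    ContDiff ℝ (⊤ : ℕ∞) (pd2 f α β) := contDiff_pd (contDiff_pd hf β) α

lemma pd2_comm {f : (Fin 4 → ℝ) → ℝ} (hf : ContDiff ℝ (⊤ : ℕ∞) f) (α β : Fin 4)
    (y : Fin 4 → ℝ) : pd2 f α β y = pd2 f β α y := by
  have hd : Differentiable ℝ (fderiv ℝ f) :=
    (hf.fderiv_right (m := (⊤ : ℕ∞)) (by simp)).differentiable (by simp)
  have e : ∀ α β, pd2 f α β y = fderiv ℝ (fderiv ℝ f) y (Pi.single α 1) (Pi.single β 1) :=
    fun α β => by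
      unfold pd2 pd
      rw [fderiv_clm_apply (hd y) (differentiableAt_const _)]
      simp
  rw [e, e]
  exact (hf.contDiffAt.isSymmSndFDerivAt 
    (by simpa using WithTop.coe_le_coe.2 (le_top : (2 : ℕ∞) ≤ ⊤))) _ _

lemma ZV_eq (i : Fin 11) (μ : Fin 4) :
    (fun y => ZV i y μ) = fun y => ZV i 0 μ + ∑ α, zmat i α μ * y α := by
  funext y
  have := ZV_affine i 0 y μ
  rwa [zero_add] at this

lemma contDiff_ZV (i : Fin 11) (μ : Fin 4) : ContDiff ℝ (⊤ : ℕ∞) (fun y => ZV i y μ) := by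
  rw [ZV_eq]; fun_prop

lemma contDiff_Zap {f : (Fin 4 → ℝ) → ℝ} (hf : ContDiff ℝ (⊤ : ℕ∞) f) (i : Fin 11) :
    ContDiff ℝ (⊤ : ℕ∞) (Zap (ZV i) f) :=
  ContDiff.sum fun μ _ => (contDiff_ZV i μ).mul (contDiff_pd hf μ)

lemma pd_add {f g : (Fin 4 → ℝ) → ℝ} (hf : ContDiff ℝ (⊤ : ℕ∞) f)
    (hg : ContDiff ℝ (⊤ : ℕ∞) g) (α : Fin 4) (y : Fin 4 → ℝ) :
    pd (fun z => f z + g z) α y = pd f α y + pd g α y := by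
  unfold pd
  rw [fderiv_fun_add (contDiff_differentiable hf y) (contDiff_differentiable hg y)]
  rfl

lemma pd_mul {f g : (Fin 4 → ℝ) → ℝ} (hf : ContDiff ℝ (⊤ : ℕ∞) f)
    (hg : ContDiff ℝ (⊤ : ℕ∞) g) (α : Fin 4) (y : Fin 4 → ℝ) :
    pd (fun z => f z * g z) α y = pd f α y * g y + f y * pd g α y := by
  unfold pd
  rw [fderiv_fun_mul (contDiff_differentiable hf y) (contDiff_differentiable hg y)]
  simp
  ring

lemma pd_const_mul {f : (Fin 4 → ℝ) → ℝ} (c : ℝ) (hf : ContDiff ℝ (⊤ : ℕ∞) f)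
    (α : Fin 4) (y : Fin 4 → ℝ) : pd (fun z => c * f z) α y = c * pd f α y := by
  unfold pd
  rw [fderiv_const_mul (contDiff_differentiable hf y)]
  rfl

lemma pd_sum {ι : Type*} (s : Finset ι) {f : ι → (Fin 4 → ℝ) → ℝ}
    (hf : ∀ i, ContDiff ℝ (⊤ : ℕ∞) (f i)) (α : Fin 4) (y : Fin 4 → ℝ) :
    pd (fun z => ∑ i ∈ s, f i z) α y = ∑ i ∈ s, pd (f i) α y := by
  unfold pd
  rw [fderiv_fun_sum fun i _ => contDiff_differentiable (hf i) y]
  simp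

lemma pd_ZV (i : Fin 11) (μ α : Fin 4) (y : Fin 4 → ℝ) :
    pd (fun y => ZV i y μ) α y = zmat i α μ := by
  have h : HasFDerivAt (fun y => ZV i y μ)
      (∑ α, zmat i α μ • (ContinuousLinearMap.proj α : (Fin 4 → ℝ) →L[ℝ] ℝ)) y := by
    rw [ZV_eq]
    refine HasFDerivAt.const_add _ (HasFDerivAt.fun_sum fun α _ => ?_)
    exact ((ContinuousLinearMap.proj α : (Fin 4 → ℝ) →L[ℝ] ℝ).hasFDerivAt).const_mul _
  unfold pd
  rw [h.fderiv]
  simp [Pi.single_apply]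

lemma pd_Zap {f : (Fin 4 → ℝ) → ℝ} (hf : ContDiff ℝ (⊤ : ℕ∞) f) (i : Fin 11) (α : Fin 4)
    (y : Fin 4 → ℝ) : pd (Zap (ZV i) f) α y
      = ∑ μ, zmat i α μ * pd f μ y + ∑ μ, ZV i y μ * pd2 f α μ y := by
  unfold Zap
  rw [pd_sum _ (fun μ => (contDiff_ZV i μ).mul (contDiff_pd hf μ)), ← Finset.sum_add_distrib]
  refine Finset.sum_congr rfl fun μ _ => ?_
  rw [pd_mul (contDiff_ZV i μ) (contDiff_pd hf μ), pd_ZV]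
  rfl

lemma zdot_pd2 {f : (Fin 4 → ℝ) → ℝ} (hf : ContDiff ℝ (⊤ : ℕ∞) f) (y : Fin 4 → ℝ)
    (i : Fin 11) (ν : Fin 4) :
    zdot i y (fun μ => pd2 f μ ν y)
      = pd (Zap (ZV i) f) ν y - ∑ μ, zmat i ν μ * pd f μ y := by
  rw [pd_Zap hf, zdot, add_sub_cancel_left]
  exact Finset.sum_congr rfl fun μ _ => by rw [pd2_comm hf]

lemma pd2_Zap {f : (Fin 4 → ℝ) → ℝ} (hf : ContDiff ℝ (⊤ : ℕ∞) f) (i : Fin 11) (α β : Fin 4)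
    (y : Fin 4 → ℝ) : pd2 (Zap (ZV i) f) α β y
      = ∑ μ, zmat i β μ * pd2 f α μ y + ∑ μ, zmat i α μ * pd2 f β μ y
        + ∑ μ, ZV i y μ * pd (pd2 f α β) μ y := by
  have e : pd (Zap (ZV i) f) β
      = fun y => ∑ μ, zmat i β μ * pd f μ y + ∑ μ, ZV i y μ * pd2 f β μ y :=
    funext fun y => pd_Zap hf i β y
  have c1 : ∀ μ, ContDiff ℝ (⊤ : ℕ∞) fun y => zmat i β μ * pd f μ y := fun μ =>
    contDiff_const.mul (contDiff_pd hf μ)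
  have c2 : ∀ μ, ContDiff ℝ (⊤ : ℕ∞) fun y => ZV i y μ * pd2 f β μ y := fun μ =>
    (contDiff_ZV i μ).mul (contDiff_pd2 hf β μ)
  have hsym : ∀ μ, pd (pd2 f β μ) α y = pd (pd2 f α β) μ y := fun μ => by
    have : pd2 f β μ = pd2 f μ β := funext fun z => pd2_comm hf β μ z
    rw [this]
    exact pd2_comm (contDiff_pd hf β) α μ y
  have e₂ : ∑ μ, pd (fun y => ZV i y μ * pd2 f β μ y) α y
      = ∑ μ, zmat i α μ * pd2 f β μ y + ∑ μ, ZV i y μ * pd (pd2 f α β) μ y := by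
    rw [← Finset.sum_add_distrib]
    refine Finset.sum_congr rfl fun μ _ => ?_
    rw [pd_mul (contDiff_ZV i μ) (contDiff_pd2 hf β μ), pd_ZV, hsym]
  rw [pd2, e, pd_add (ContDiff.sum fun μ _ => c1 μ) (ContDiff.sum fun μ _ => c2 μ),
    pd_sum _ c1, pd_sum _ c2, add_assoc, e₂]
  congr 1
  exact Finset.sum_congr rfl fun μ _ => pd_const_mul _ (contDiff_pd hf μ) _ _

lemma contDiff_boxg {H : (Fin 4 → ℝ) → Fin 4 → Fin 4 → ℝ} {f : (Fin 4 → ℝ) → ℝ}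
    (hf : ContDiff ℝ (⊤ : ℕ∞) f) (hH : ∀ α β, ContDiff ℝ (⊤ : ℕ∞) (fun y => H y α β)) :
    ContDiff ℝ (⊤ : ℕ∞) (boxg H f) :=
  (ContDiff.sum fun α _ => ContDiff.sum fun β _ => contDiff_const.mul (contDiff_pd2 hf α β)).add
    (ContDiff.sum fun α _ => ContDiff.sum fun β _ => (hH α β).mul (contDiff_pd2 hf α β))

lemma pd_boxg {H : (Fin 4 → ℝ) → Fin 4 → Fin 4 → ℝ} {f : (Fin 4 → ℝ) → ℝ}
    (hf : ContDiff ℝ (⊤ : ℕ∞) f) (hH : ∀ α β, ContDiff ℝ (⊤ : ℕ∞) (fun y => H y α β))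
    (μ : Fin 4) (y : Fin 4 → ℝ) :
    pd (boxg H f) μ y = ∑ α, ∑ β, mink α β * pd (pd2 f α β) μ y
      + ∑ α, ∑ β, (pd (fun z => H z α β) μ y * pd2 f α β y
        + H y α β * pd (pd2 f α β) μ y) := by
  have c1 : ∀ α β, ContDiff ℝ (⊤ : ℕ∞) fun y => mink α β * pd2 f α β y := fun α β =>
    contDiff_const.mul (contDiff_pd2 hf α β)
  have c2 : ∀ α β, ContDiff ℝ (⊤ : ℕ∞) fun y => H y α β * pd2 f α β y := fun α β =>
    (hH α β).mul (contDiff_pd2 hf α β)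
  unfold boxg box
  rw [pd_add (ContDiff.sum fun α _ => ContDiff.sum fun β _ => c1 α β)
    (ContDiff.sum fun α _ => ContDiff.sum fun β _ => c2 α β),
    pd_sum _ (fun α => ContDiff.sum fun β _ => c1 α β),
    pd_sum _ (fun α => ContDiff.sum fun β _ => c2 α β)]
  congr 1
  · refine Finset.sum_congr rfl fun α _ => ?_
    rw [pd_sum _ (c1 α)]
    exact Finset.sum_congr rfl fun β _ => pd_const_mul _ (contDiff_pd2 hf α β) _ _
  · refine Finset.sum_congr rfl fun α _ => ?_
    rw [pd_sum _ (c2 α)]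
    exact Finset.sum_congr rfl fun β _ => pd_mul (hH α β) (contDiff_pd2 hf α β) _ _

lemma mink_zmat (i : Fin 11) (h : Fin 4 → Fin 4 → ℝ) (hh : ∀ α β, h α β = h β α) :
    ∑ α, ∑ β, mink α β * (∑ μ, zmat i β μ * h α μ + ∑ μ, zmat i α μ * h β μ)
      = (if i = 10 then 2 else 0) * ∑ α, ∑ β, mink α β * h α β := by
  have h10 := hh 1 0
  have h20 := hh 2 0
  have h30 := hh 3 0
  have h21 := hh 2 1
  have h31 := hh 3 1
  have h32 := hh 3 2
  fin_cases i <;>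
    simp [mink, zmat, ZV, dVF, omVF, sVF, lowerc, Fin.sum_univ_four, h10, h20, h30, h21, h31,
      h32] <;> ring

lemma pert_zmat (i : Fin 11) (H h : Fin 4 → Fin 4 → ℝ) (hH : ∀ α β, H α β = H β α)
    (hh : ∀ α β, h α β = h β α) :
    ∑ α, ∑ β, H α β * (∑ μ, zmat i β μ * h α μ + ∑ μ, zmat i α μ * h β μ)
      = ∑ α, ∑ β, (2 * ∑ γ, H γ β * zmat i γ α) * h α β := by
  have h10 := hh 1 0
  have h20 := hh 2 0
  have h30 := hh 3 0
  have h21 := hh 2 1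
  have h31 := hh 3 1
  have h32 := hh 3 2
  have H10 := hH 1 0
  have H20 := hH 2 0
  have H30 := hH 3 0
  have H21 := hH 2 1
  have H31 := hH 3 1
  have H32 := hH 3 2
  simp only [Fin.sum_univ_four, h10, h20, h30, h21, h31, h32, H10, H20, H30, H21, H31, H32]
  ring

lemma boxg_Zap {H : (Fin 4 → ℝ) → Fin 4 → Fin 4 → ℝ} {f : (Fin 4 → ℝ) → ℝ}
    (hf : ContDiff ℝ (⊤ : ℕ∞) f) (hH : ∀ α β, ContDiff ℝ (⊤ : ℕ∞) (fun y => H y α β))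
    (hs : ∀ y α β, H y α β = H y β α) (i : Fin 11) (y : Fin 4 → ℝ) :
    boxg H (Zap (ZV i) f) y = Zap (ZV i) (boxg H f) y
      + (if i = 10 then 2 else 0) * boxg H f y
      + ∑ α, ∑ β, ktens i (H y) (Zten (ZV i) H y) α β * pd2 f α β y := by
  have hsym := pd2_comm hf
  have hm := mink_zmat i (fun α β => pd2 f α β y) fun α β => hsym α β y
  have hp := pert_zmat i (H y) (fun α β => pd2 f α β y) (hs y) fun α β => hsym α β y
  have e1 : boxg H (Zap (ZV i) f) y
      = (if i = 10 then 2 else 0) * (∑ α, ∑ β, mink α β * pd2 f α β y)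
        + ∑ α, ∑ β, (2 * ∑ γ, H y γ β * zmat i γ α) * pd2 f α β y
        + ∑ α, ∑ β, (mink α β + H y α β) * ∑ μ, ZV i y μ * pd (pd2 f α β) μ y := by
    rw [← hm, ← hp, boxg, box]
    simp only [pd2_Zap hf, mul_add, add_mul, Finset.sum_add_distrib]
    ring
  have e2 : Zap (ZV i) (boxg H f) y
      = ∑ α, ∑ β, (mink α β + H y α β) * ∑ μ, ZV i y μ * pd (pd2 f α β) μ y
        + ∑ α, ∑ β, Zten (ZV i) H y α β * pd2 f α β y := by
    simp only [Zten, Zap, pd_boxg hf hH, Fin.sum_univ_four]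
    ring
  have e3 : ∑ α, ∑ β, ktens i (H y) (Zten (ZV i) H y) α β * pd2 f α β y
      = -(∑ α, ∑ β, Zten (ZV i) H y α β * pd2 f α β y)
        + (∑ α, ∑ β, (2 * ∑ γ, H y γ β * zmat i γ α) * pd2 f α β y)
        - (if i = 10 then 2 else 0) * ∑ α, ∑ β, H y α β * pd2 f α β y := by
    simp only [ktens, Finset.mul_sum, ← Finset.sum_neg_distrib, ← Finset.sum_add_distrib,
      ← Finset.sum_sub_distrib]
    refine Finset.sum_congr rfl fun α _ => Finset.sum_congr rfl fun β _ => ?_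
    ring
  rw [e1, e2, e3, boxg, box]
  ring

lemma pd_eq_of_eqOn_slab {f g : (Fin 4 → ℝ) → ℝ} (hf : ContDiff ℝ (⊤ : ℕ∞) f)
    (hg : ContDiff ℝ (⊤ : ℕ∞) g) {T : ℝ} (hT : 0 < T)
    (h : ∀ y : Fin 4 → ℝ, 0 ≤ y 0 → y 0 ≤ T → f y = g y) (μ : Fin 4) (y : Fin 4 → ℝ)
    (hy0 : 0 ≤ y 0) (hyT : y 0 ≤ T) : pd f μ y = pd g μ y := by
  set s : Set (Fin 4 → ℝ) := {y | 0 ≤ y 0 ∧ y 0 ≤ T} with hs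
  have hconv : Convex ℝ s := by
    rintro a ⟨ha0, ha1⟩ b ⟨hb0, hb1⟩ c d hc hd hcd
    simp only [hs, Set.mem_ofPred_eq, Pi.add_apply, Pi.smul_apply, smul_eq_mul]
    constructor
    · positivity
    · calc c * a 0 + d * b 0 ≤ c * T + d * T := by gcongr
        _ = T := by rw [← add_mul, hcd, one_mul]
  have h_interior : (interior s).Nonempty := by
    have ho : IsOpen {y : Fin 4 → ℝ | 0 < y 0 ∧ y 0 < T} :=
      (isOpen_lt continuous_const (continuous_apply 0)).inter
        (isOpen_lt (continuous_apply 0) continuous_const)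
    refine ⟨fun _ => T / 2, interior_maximal ?_ ho ⟨by positivity, by linarith⟩⟩
    exact fun y hy => ⟨hy.1.le, hy.2.le⟩
  have hu : UniqueDiffWithinAt ℝ s y := uniqueDiffOn_convex hconv h_interior y ⟨hy0, hyT⟩
  unfold pd
  rw [← (contDiff_differentiable hf y).fderivWithin hu,
    ← (contDiff_differentiable hg y).fderivWithin hu,
    fderivWithin_congr (fun z hz => h z hz.1 hz.2) (h y hy0 hyT)]

lemma continuous_rad : Continuous rad := by
  unfold rad nr3 sp
  fun_prop

/-- The `L̄`-derivative of `ψ`, multiplied by `r`. -/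
def ufun (ψ : (Fin 4 → ℝ) → ℝ) (y : Fin 4 → ℝ) : ℝ :=
  rad y * pd ψ 0 y - ∑ i : Fin 3, y i.succ * pd ψ i.succ y

lemma continuous_ufun {ψ : (Fin 4 → ℝ) → ℝ} (hψ : ContDiff ℝ (⊤ : ℕ∞) ψ) :
    Continuous (ufun ψ) := by
  have h : ∀ μ, Continuous (pd ψ μ) := fun μ => (contDiff_pd hψ μ).continuous
  have h0 := continuous_rad
  have h1 := h 0
  have h2 : ∀ i : Fin 3, Continuous (pd ψ i.succ) := fun i => h _
  unfold ufun
  fun_prop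

lemma ufun_eq {ψ : (Fin 4 → ℝ) → ℝ} {y : Fin 4 → ℝ} (hr : 0 < rad y) :
    ufun ψ y = rad y * ∑ μ, vecLb (uom y) μ * pd ψ μ y := by
  obtain ⟨e1, e2, e3⟩ := coord_eq_rad_mul_uom hr
  simp [ufun, Fin.sum_univ_three, Fin.sum_univ_four, vecLb]
  rw [e1, e2, e3]
  ring

lemma hasDerivAt_line {f : (Fin 4 → ℝ) → ℝ} (hf : ContDiff ℝ (⊤ : ℕ∞) f)
    (y v : Fin 4 → ℝ) :
    HasDerivAt (fun s : ℝ => f (y + s • v)) (∑ ν, v ν * pd f ν y) 0 := by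
  have hl : HasDerivAt (fun s : ℝ => y + s • v) v 0 := by
    simpa using ((hasDerivAt_id (0 : ℝ)).smul_const v).const_add y
  have hfd : HasFDerivAt f (fderiv ℝ f y) (y + (0 : ℝ) • v) := by
    simpa using (contDiff_differentiable hf y).hasFDerivAt
  have h := hfd.comp_hasDerivAt (0 : ℝ) hl
  have e : fderiv ℝ f y v = ∑ ν, v ν * pd f ν y := by
    conv_lhs => rw [pi_eq_sum_univ' v]
    rw [map_sum]
    refine Finset.sum_congr rfl fun ν _ => ?_
    rw [map_smul, smul_eq_mul, pd]
  rw [← e]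
  exact h

lemma hasDerivAt_line_rad {y : Fin 4 → ℝ} (hr : 0 < rad y) (v : Fin 4 → ℝ) :
    HasDerivAt (fun s : ℝ => rad (y + s • v)) (∑ i : Fin 3, uom y i * v i.succ) 0 := by
  have h : HasDerivAt (fun s : ℝ => ∑ i : Fin 3, (y i.succ + s * v i.succ) ^ 2)
      (∑ i : Fin 3, 2 * (y i.succ * v i.succ)) 0 := by
    refine HasDerivAt.fun_sum fun i _ => ?_
    have := (((hasDerivAt_id (0 : ℝ)).mul_const (v i.succ)).const_add (y i.succ)).pow 2
    refine this.congr_deriv ?_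
    simp
    ring
  have hne : ∑ i : Fin 3, (y i.succ + 0 * v i.succ) ^ 2 ≠ 0 := by
    have h0 : 0 < rad y ^ 2 := by positivity
    rw [rad_sq] at h0
    simp only [zero_mul, add_zero, Fin.sum_univ_three]
    exact h0.ne'
  have h2 := h.sqrt hne
  have e0 : √(∑ i : Fin 3, (y i.succ + 0 * v i.succ) ^ 2) = rad y := by
    simp [rad, nr3, sp]
  rw [e0] at h2
  refine h2.congr_deriv ?_
  simp only [uom, sp, ← Finset.mul_sum]
  rw [mul_div_mul_left _ _ two_ne_zero, Finset.sum_div]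
  exact Finset.sum_congr rfl fun i _ => by ring

lemma hasDerivAt_line_ufun {ψ : (Fin 4 → ℝ) → ℝ} (hψ : ContDiff ℝ (⊤ : ℕ∞) ψ)
    {y : Fin 4 → ℝ} (hr : 0 < rad y) (H : Fin 4 → Fin 4 → ℝ) :
    HasDerivAt (fun s : ℝ => ufun ψ (y + s • xdir H (uom y)))
      (xu H (fun ν μ => pd2 ψ ν μ y) y (fun μ => pd ψ μ y)) 0 := by
  set v := xdir H (uom y) with hv
  have h1 := (hasDerivAt_line_rad hr v).mul (hasDerivAt_line (contDiff_pd hψ 0) y v)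
  have h2 : HasDerivAt (fun s : ℝ => ∑ i : Fin 3, (y + s • v) i.succ * pd ψ i.succ (y + s • v))
      (∑ i : Fin 3, (v i.succ * pd ψ i.succ y
        + y i.succ * ∑ ν, v ν * pd (pd ψ i.succ) ν y)) 0 := by
    refine HasDerivAt.fun_sum fun i _ => ?_
    have hl : HasDerivAt (fun s : ℝ => (y + s • v) i.succ) (v i.succ) 0 := by
      simpa using ((hasDerivAt_id (0 : ℝ)).mul_const (v i.succ)).const_add (y i.succ)
    refine (hl.mul (hasDerivAt_line (contDiff_pd hψ i.succ) y v)).congr_deriv ?_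
    simp
  refine (h1.sub h2).congr_deriv ?_
  obtain ⟨e1, e2, e3⟩ := coord_eq_rad_mul_uom hr
  unfold xu
  rw [← hv]
  simp [Fin.sum_univ_four, Fin.sum_univ_three, vecLb, pd2]
  rw [e1, e2, e3]
  ring

/-- `∑_{|I|=1} |Z^I f|` -/
def zabs₁ (f : (Fin 4 → ℝ) → ℝ) (y : Fin 4 → ℝ) : ℝ := ∑ i : Fin 11, |Zap (ZV i) f y|

/-- `∑_{|I|=2} |Z^I f|` -/
def zabs₂ (f : (Fin 4 → ℝ) → ℝ) (y : Fin 4 → ℝ) : ℝ := ∑ i : Fin 11, zabs₁ (Zap (ZV i) f) y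

/-- `∑_{|I|=3} |Z^I f|` -/
def zabs₃ (f : (Fin 4 → ℝ) → ℝ) (y : Fin 4 → ℝ) : ℝ := ∑ i : Fin 11, zabs₂ (Zap (ZV i) f) y

lemma zabs₁_nonneg (f : (Fin 4 → ℝ) → ℝ) (y : Fin 4 → ℝ) : 0 ≤ zabs₁ f y :=
  Finset.sum_nonneg fun _ _ => abs_nonneg _

lemma zabs₂_nonneg (f : (Fin 4 → ℝ) → ℝ) (y : Fin 4 → ℝ) : 0 ≤ zabs₂ f y :=
  Finset.sum_nonneg fun _ _ => zabs₁_nonneg _ _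

lemma zabs₃_nonneg (f : (Fin 4 → ℝ) → ℝ) (y : Fin 4 → ℝ) : 0 ≤ zabs₃ f y :=
  Finset.sum_nonneg fun _ _ => zabs₂_nonneg _ _

/-- The functions `Z^I φ` with `|I| ≤ 1`. -/
def fam (φ : (Fin 4 → ℝ) → ℝ) : Option (Fin 11) → (Fin 4 → ℝ) → ℝ
  | none => φ
  | some i => Zap (ZV i) φ

lemma contDiff_fam {φ : (Fin 4 → ℝ) → ℝ} (hφ : ContDiff ℝ (⊤ : ℕ∞) φ) (j : Option (Fin 11)) :
    ContDiff ℝ (⊤ : ℕ∞) (fam φ j) := by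
  cases j with
  | none => exact hφ
  | some i => exact contDiff_Zap hφ i

lemma sum_zabs₁_fam (φ : (Fin 4 → ℝ) → ℝ) (y : Fin 4 → ℝ) :
    ∑ j, zabs₁ (fam φ j) y = zabs₁ φ y + zabs₂ φ y := Fintype.sum_option _

lemma rad_mul_abs_pd_le (ψ : (Fin 4 → ℝ) → ℝ) {y : Fin 4 → ℝ} (hy : 0 ≤ y 0)
    (hr : 0 < rad y) (α : Fin 4) :
    rad y * |pd ψ α y| ≤ |ufun ψ y| + 2 * zabs₁ ψ y := by
  rw [ufun_eq hr]
  exact rad_mul_abs_le α y (fun μ => pd ψ μ y) hy hr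

lemma abs_xu_le {ψ : (Fin 4 → ℝ) → ℝ} (hψ : ContDiff ℝ (⊤ : ℕ∞) ψ) {η : ℝ}
    {y : Fin 4 → ℝ} (hy : 0 ≤ y 0) (hr : 0 < rad y)
    {H : (Fin 4 → ℝ) → Fin 4 → Fin 4 → ℝ} (hs : ∀ y α β, H y α β = H y β α)
    (hη : η ≤ 1 / 4) (hb : ∀ α β, |H y α β| ≤ η) :
    |xu (H y) (fun ν μ => pd2 ψ ν μ y) y (fun μ => pd ψ μ y)|
      ≤ rad y * |boxg H ψ y| + 20 * (rad y)⁻¹ * (zabs₁ ψ y + zabs₂ ψ y)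
        + 3000 * η * ∑ μ, |pd ψ μ y| := by
  have h := transport_bound y (fun μ => pd ψ μ y) hy hr (H y) (fun ν μ => pd2 ψ ν μ y) (hs y)
    (fun α β => pd2_comm hψ α β y) hη hb (fun i ν => pd (Zap (ZV i) ψ) ν y)
    fun i ν => zdot_pd2 hψ y i ν
  change |_ + rad y * boxg H ψ y| ≤ 20 * (rad y)⁻¹ * (zabs₁ ψ y + zabs₂ ψ y) + _ at h
  have h2 := abs_sub (xu (H y) (fun ν μ => pd2 ψ ν μ y) y (fun μ => pd ψ μ y)
    + rad y * boxg H ψ y) (rad y * boxg H ψ y)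
  rw [add_sub_cancel_right, abs_mul, abs_of_pos hr] at h2
  linarith

lemma rad_mul_abs_boxg_Zap_le {φ : (Fin 4 → ℝ) → ℝ} (hφ : ContDiff ℝ (⊤ : ℕ∞) φ) {η : ℝ}
    {y : Fin 4 → ℝ} (hy : 0 ≤ y 0) (hr : 0 < rad y)
    {H : (Fin 4 → ℝ) → Fin 4 → Fin 4 → ℝ}
    (hH : ∀ α β, ContDiff ℝ (⊤ : ℕ∞) (fun y => H y α β))
    (hs : ∀ y α β, H y α β = H y β α)
    (hb : tnorm (H y) + (∑ i : Fin 11, tnorm (Zten (ZV i) H y)) ≤ η)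
    (hLL : ∀ s₁ s₂ : Fin 3 → ℝ, IsFrame (uom y) s₁ s₂ →
      |con2 (H y) (vecLlow (uom y)) (vecLlow (uom y))|
        + (∑ i : Fin 11, |con2 (Zten (ZV i) H y) (vecLlow (uom y)) (vecLlow (uom y))|)
        + normLT (H y) (uom y) s₁ s₂
        ≤ η * (1 + |qq y|) / (1 + y 0 + rad y)) (i : Fin 11) :
    rad y * |boxg H (Zap (ZV i) φ) y|
      ≤ rad y * (|Zap (ZV i) (boxg H φ) y| + 2 * |boxg H φ y|)
        + 300 * η * ∑ ν, ((∑ k, |pd (Zap (ZV k) φ) ν y|) + 11 * ∑ μ, |pd φ μ y|) := by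
  obtain ⟨s₁, s₂, hf⟩ := exists_frame (uom y) (uom_sq hr)
  have hL := hLL s₁ s₂ hf
  set κ := η * (1 + |qq y|) / (1 + y 0 + rad y)
  have hn : ∀ k, 0 ≤ tnorm (Zten (ZV k) H y) := fun k => tnorm_nonneg _
  have hη0 : 0 ≤ η :=
    le_trans (add_nonneg (tnorm_nonneg _) (Finset.sum_nonneg fun k _ => hn k)) hb
  have hHb : ∀ α β, |H y α β| ≤ η := fun α β => by
    linarith [abs_le_tnorm (H y) α β, Finset.sum_nonneg fun k (_ : k ∈ Finset.univ) => hn k]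
  have hQb : ∀ α β, |Zten (ZV i) H y α β| ≤ η := fun α β => by
    linarith [abs_le_tnorm (Zten (ZV i) H y) α β, tnorm_nonneg (H y),
      Finset.single_le_sum (fun k _ => hn k) (Finset.mem_univ i)]
  have hQL : |con2 (Zten (ZV i) H y) (vecLlow (uom y)) (vecLlow (uom y))| ≤ κ := by
    have := Finset.single_le_sum (f := fun i =>
      |con2 (Zten (ZV i) H y) (vecLlow (uom y)) (vecLlow (uom y))|)
      (fun k _ => abs_nonneg _) (Finset.mem_univ i)
    have h2 : 0 ≤ normLT (H y) (uom y) s₁ s₂ := by unfold normLT; positivity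
    linarith [abs_nonneg (con2 (H y) (vecLlow (uom y)) (vecLlow (uom y)))]
  have hLT : normLT (H y) (uom y) s₁ s₂ ≤ κ := by
    have := Finset.sum_nonneg (s := Finset.univ) fun (k : Fin 11) _ =>
      abs_nonneg (con2 (Zten (ZV k) H y) (vecLlow (uom y)) (vecLlow (uom y)))
    linarith [abs_nonneg (con2 (H y) (vecLlow (uom y)) (vecLlow (uom y)))]
  have hK := rad_mul_abs_contraction_le y hy hr (ktens i (H y) (Zten (ZV i) H y))
    (fun α β => pd2 φ α β y) (fun α β => pd2_comm hφ α β y) (abs_ktens_le i _ _ hHb hQb)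
    (abs_con2_ktens_le hr i _ _ (hs y) hf hQL hLT) le_rfl
  have hz : ∑ μ, zsum y (fun ν => pd2 φ ν μ y)
      ≤ ∑ ν, ((∑ k, |pd (Zap (ZV k) φ) ν y|) + 11 * ∑ μ, |pd φ μ y|) :=
    Finset.sum_le_sum fun ν _ => zsum_hess_le y (fun μ => pd φ μ y) (fun α β => pd2 φ α β y)
      (fun i ν => pd (Zap (ZV i) φ) ν y) (fun i ν => zdot_pd2 hφ y i ν) ν
  have hz' := mul_le_mul_of_nonneg_left hz (by positivity : 0 ≤ 300 * η)
  rw [boxg_Zap hφ hH hs]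
  set K := ∑ α, ∑ β, ktens i (H y) (Zten (ZV i) H y) α β * pd2 φ α β y
  have hc : |(if i = 10 then (2 : ℝ) else 0) * boxg H φ y| ≤ 2 * |boxg H φ y| := by
    rw [abs_mul]
    gcongr
    split_ifs <;> norm_num
  have h3 := abs_add_three (Zap (ZV i) (boxg H φ) y)
    ((if i = 10 then (2 : ℝ) else 0) * boxg H φ y) K
  have h4 : rad y * |Zap (ZV i) (boxg H φ) y + (if i = 10 then (2 : ℝ) else 0) * boxg H φ y + K|
      ≤ rad y * (|Zap (ZV i) (boxg H φ) y| + 2 * |boxg H φ y| + |K|) := by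
    gcongr
    linarith
  rw [mul_add] at h4
  linarith

lemma abs_xu_fam_le {φ F : (Fin 4 → ℝ) → ℝ} (hφ : ContDiff ℝ (⊤ : ℕ∞) φ)
    (hF : ContDiff ℝ (⊤ : ℕ∞) F) {ε T : ℝ} (hε1 : ε ≤ 1) (hT : 0 < T)
    {H : (Fin 4 → ℝ) → Fin 4 → Fin 4 → ℝ}
    (hH : ∀ α β, ContDiff ℝ (⊤ : ℕ∞) (fun y => H y α β))
    (hs : ∀ y α β, H y α β = H y β α)
    (hsol : ∀ y : Fin 4 → ℝ, 0 ≤ y 0 → y 0 ≤ T → boxg H φ y = F y)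
    {y : Fin 4 → ℝ} (hy1 : 1 ≤ y 0) (hyT : y 0 ≤ T)
    (hr1 : y 0 / 2 ≤ rad y) (hr2 : rad y ≤ 2 * y 0)
    (hb : tnorm (H y) + (∑ i : Fin 11, tnorm (Zten (ZV i) H y)) ≤ ε / 4)
    (hLL : ∀ s₁ s₂ : Fin 3 → ℝ, IsFrame (uom y) s₁ s₂ →
      |con2 (H y) (vecLlow (uom y)) (vecLlow (uom y))|
        + (∑ i : Fin 11, |con2 (Zten (ZV i) H y) (vecLlow (uom y)) (vecLlow (uom y))|)
        + normLT (H y) (uom y) s₁ s₂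
        ≤ (ε / 4) * (1 + |qq y|) / (1 + y 0 + rad y)) (j : Option (Fin 11)) :
    |xu (H y) (fun ν μ => pd2 (fam φ j) ν μ y) y (fun μ => pd (fam φ j) μ y)|
      ≤ 130000 * (ε / (1 + y 0) * ∑ k, |ufun (fam φ k) y|
        + ((1 + y 0) * (|F y| + zabs₁ F y)
          + (1 + y 0)⁻¹ * (|φ y| + zabs₁ φ y + zabs₂ φ y + zabs₃ φ y))) := by
  have hy : 0 ≤ y 0 := by linarith
  have hr : 0 < rad y := by linarith
  have hη0 : 0 ≤ ε / 4 :=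
    le_trans (add_nonneg (tnorm_nonneg _) (Finset.sum_nonneg fun k _ => tnorm_nonneg _)) hb
  have hHb : ∀ α β, |H y α β| ≤ ε / 4 := fun α β => by
    linarith [abs_le_tnorm (H y) α β,
      Finset.sum_nonneg fun k (_ : k ∈ Finset.univ) => tnorm_nonneg (Zten (ZV k) H y)]
  set D := ∑ k, ∑ μ, |pd (fam φ k) μ y| with hD
  set U := ∑ k, |ufun (fam φ k) y| with hU
  have hU0 : 0 ≤ U := Finset.sum_nonneg fun _ _ => abs_nonneg _
  have n1 := zabs₁_nonneg φ y
  have n2 := zabs₂_nonneg φ y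
  have n3 := zabs₃_nonneg φ y
  have nF := zabs₁_nonneg F y
  have hφ0 := abs_nonneg (φ y)
  have hF0 := abs_nonneg (F y)
  have hDj : ∀ j, ∑ μ, |pd (fam φ j) μ y| ≤ D := fun j =>
    Finset.single_le_sum (f := fun k => ∑ μ, |pd (fam φ k) μ y|)
      (fun k _ => Finset.sum_nonneg fun _ _ => abs_nonneg _) (Finset.mem_univ j)
  have hDU : rad y * D ≤ 4 * U + 8 * (zabs₁ φ y + zabs₂ φ y) := by
    have : rad y * D ≤ ∑ k, ∑ _μ : Fin 4, (|ufun (fam φ k) y| + 2 * zabs₁ (fam φ k) y) := by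
      rw [hD, Finset.mul_sum]
      refine Finset.sum_le_sum fun k _ => ?_
      rw [Finset.mul_sum]
      exact Finset.sum_le_sum fun μ _ => rad_mul_abs_pd_le _ hy hr μ
    refine this.trans_eq ?_
    simp only [Finset.sum_const, Finset.card_univ, Fintype.card_fin, nsmul_eq_mul]
    rw [← Finset.mul_sum, Finset.sum_add_distrib, ← Finset.mul_sum, sum_zabs₁_fam]
    push_cast
    ring
  have hbox : rad y * |boxg H (fam φ j) y| ≤ rad y * (2 * |F y| + zabs₁ F y)
      + 3300 * ε * D := by
    have hD0 : 0 ≤ D :=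
      Finset.sum_nonneg fun _ _ => Finset.sum_nonneg fun _ _ => abs_nonneg _
    cases j with
    | none =>
      change rad y * |boxg H φ y| ≤ _
      rw [hsol y hy hyT]
      have : rad y * |F y| ≤ rad y * (2 * |F y| + zabs₁ F y) := by gcongr; linarith
      nlinarith [mul_nonneg hη0 hD0]
    | some i =>
      have h := rad_mul_abs_boxg_Zap_le hφ hy hr hH hs hb hLL i
      have hZ : Zap (ZV i) (boxg H φ) y = Zap (ZV i) F y :=
        Finset.sum_congr rfl fun μ _ => by
          rw [pd_eq_of_eqOn_slab (contDiff_boxg hφ hH) hF hT hsol μ y hy hyT]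
      rw [hZ, hsol y hy hyT] at h
      have hZF : |Zap (ZV i) F y| ≤ zabs₁ F y :=
        Finset.single_le_sum (f := fun i => |Zap (ZV i) F y|) (fun _ _ => abs_nonneg _)
          (Finset.mem_univ i)
      have h2 : rad y * (|Zap (ZV i) F y| + 2 * |F y|) ≤ rad y * (2 * |F y| + zabs₁ F y) :=
        mul_le_mul_of_nonneg_left (by linarith) hr.le
      have h3 : ∑ ν, ((∑ k, |pd (Zap (ZV k) φ) ν y|) + 11 * ∑ μ, |pd φ μ y|) ≤ 44 * D := by
        rw [Finset.sum_add_distrib, Finset.sum_comm]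
        have e : D = ∑ μ, |pd φ μ y| + ∑ k, ∑ ν, |pd (Zap (ZV k) φ) ν y| :=
          Fintype.sum_option _
        have p1 : 0 ≤ ∑ k, ∑ ν, |pd (Zap (ZV k) φ) ν y| :=
          Finset.sum_nonneg fun _ _ => Finset.sum_nonneg fun _ _ => abs_nonneg _
        simp only [Finset.sum_const, Finset.card_univ, Fintype.card_fin, nsmul_eq_mul]
        push_cast
        linarith
      have h4 := mul_le_mul_of_nonneg_left h3 (by positivity : 0 ≤ 300 * (ε / 4))
      change rad y * |boxg H (Zap (ZV i) φ) y| ≤ _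
      linarith
  have hmain := abs_xu_le (contDiff_fam hφ j) hy hr hs (by linarith) hHb
  have hz1 : zabs₁ (fam φ j) y + zabs₂ (fam φ j) y ≤ zabs₁ φ y + zabs₂ φ y + zabs₃ φ y := by
    cases j with
    | none => change zabs₁ φ y + zabs₂ φ y ≤ _; linarith
    | some i =>
      have a1 := Finset.single_le_sum (f := fun i => zabs₁ (Zap (ZV i) φ) y)
        (fun _ _ => zabs₁_nonneg _ _) (Finset.mem_univ i)
      have a2 := Finset.single_le_sum (f := fun i => zabs₂ (Zap (ZV i) φ) y)
        (fun _ _ => zabs₂_nonneg _ _) (Finset.mem_univ i)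
      change zabs₁ (Zap (ZV i) φ) y ≤ zabs₂ φ y at a1
      change zabs₂ (Zap (ZV i) φ) y ≤ zabs₃ φ y at a2
      change zabs₁ (Zap (ZV i) φ) y + zabs₂ (Zap (ZV i) φ) y ≤ _
      linarith
  have hrinv : (rad y)⁻¹ ≤ 4 * (1 + y 0)⁻¹ := by
    rw [← div_eq_mul_inv, inv_eq_one_div, div_le_div_iff₀ hr (by linarith)]
    linarith
  set N := |φ y| + zabs₁ φ y + zabs₂ φ y + zabs₃ φ y with hN
  have hD' : D ≤ (rad y)⁻¹ * (4 * U + 8 * N) := by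
    rw [inv_mul_eq_div, le_div_iff₀ hr]
    linarith
  have t1 : 3000 * (ε / 4) * (∑ μ, |pd (fam φ j) μ y|) ≤ 750 * ε * D := by
    have := mul_le_mul_of_nonneg_left (hDj j) (by positivity : 0 ≤ 3000 * (ε / 4))
    linarith
  have t2 : 20 * (rad y)⁻¹ * (zabs₁ (fam φ j) y + zabs₂ (fam φ j) y) ≤ 20 * (rad y)⁻¹ * N := by
    gcongr; linarith
  have t3 : 4050 * ε * D ≤ 16200 * ε * ((rad y)⁻¹ * U) + 32400 * ((rad y)⁻¹ * N) := by
    have hε0 : 0 ≤ ε := by linarith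
    have := mul_le_mul_of_nonneg_left hD' (by positivity : 0 ≤ 4050 * ε)
    have h2 : ε * ((rad y)⁻¹ * N) ≤ 1 * ((rad y)⁻¹ * N) := by gcongr
    nlinarith
  have t4 : rad y * (2 * |F y| + zabs₁ F y) ≤ (2 * (1 + y 0)) * (2 * (|F y| + zabs₁ F y)) := by
    gcongr <;> linarith
  have hN0 : 0 ≤ N := by positivity
  have t5 : (rad y)⁻¹ * N ≤ 4 * (1 + y 0)⁻¹ * N := by gcongr
  have t6 : (rad y)⁻¹ * U ≤ 4 * (1 + y 0)⁻¹ * U := by gcongr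
  have t7 := mul_le_mul_of_nonneg_left t6 (by linarith : 0 ≤ 16200 * ε)
  have p1 : 0 ≤ ε / (1 + y 0) * U := by
    have : 0 ≤ ε := by linarith
    positivity
  have p2 : 0 ≤ (1 + y 0) * (|F y| + zabs₁ F y) := by positivity
  have p3 : 0 ≤ (1 + y 0)⁻¹ * N := by positivity
  have e1 : 16200 * ε * (4 * (1 + y 0)⁻¹ * U) = 64800 * (ε / (1 + y 0) * U) := by
    rw [div_eq_mul_inv]; ring
  linarith

lemma rad_tins (τ : ℝ) (x : Fin 3 → ℝ) : rad (tins τ x) = nr3 x := by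
  simp [rad, nr3, sp, tins]

lemma tins_sp (y : Fin 4 → ℝ) : tins (y 0) (sp y) = y := Fin.cons_self_tail y

lemma nr3_smul {c : ℝ} (hc : 0 ≤ c) (x : Fin 3 → ℝ) : nr3 (c • x) = c * nr3 x := by
  simp only [nr3, Pi.smul_apply, smul_eq_mul, mul_pow, ← Finset.mul_sum]
  rw [Real.sqrt_mul (sq_nonneg c), Real.sqrt_sq hc]

lemma abs_le_nr3 (x : Fin 3 → ℝ) (i : Fin 3) : |x i| ≤ nr3 x :=
  Real.abs_le_sqrt (Finset.single_le_sum (f := fun i => x i ^ 2) (fun _ _ => sq_nonneg _)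
    (Finset.mem_univ i))

lemma isCompact_Dreg (t : ℝ) : IsCompact (Dreg t) := by
  have hc : Continuous nr3 := by unfold nr3; fun_prop
  refine Metric.isCompact_of_isClosed_isBounded ?_ ?_
  · exact (isClosed_le continuous_const hc).inter (isClosed_le hc continuous_const)
  · refine (Metric.isBounded_closedBall (x := (0 : Fin 3 → ℝ)) (r := |2 * t|)).subset ?_
    intro x hx
    rw [mem_closedBall_zero_iff, pi_norm_le_iff_of_nonneg (abs_nonneg _)]
    exact fun i => (abs_le_nr3 x i).trans (hx.2.trans (le_abs_self _))

lemma Dreg_one_nonempty : (Dreg 1).Nonempty := by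
  have h : nr3 ![1, 0, 0] = 1 := by simp [nr3, Fin.sum_univ_three]
  exact ⟨![1, 0, 0], by rw [h]; norm_num, by rw [h]; norm_num⟩

lemma smul_mem_Dreg {τ : ℝ} (hτ : 0 ≤ τ) {z : Fin 3 → ℝ} (hz : z ∈ Dreg 1) :
    τ • z ∈ Dreg τ := by
  simp only [Dreg, Set.mem_ofPred_eq, nr3_smul hτ] at *
  constructor <;> nlinarith [hz.1, hz.2]

lemma inv_smul_mem_Dreg {τ : ℝ} (hτ : 0 < τ) {x : Fin 3 → ℝ} (hx : x ∈ Dreg τ) :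
    τ⁻¹ • x ∈ Dreg 1 := by
  simp only [Dreg, Set.mem_ofPred_eq, nr3_smul (inv_nonneg.2 hτ.le)] at *
  rw [inv_mul_eq_div, le_div_iff₀ hτ, div_le_iff₀ hτ]
  constructor <;> linarith [hx.1, hx.2]

/-- Real-valued version of `esupD`, with the region rescaled to a fixed one. -/
def dsup (ψ : (Fin 4 → ℝ) → ℝ) (τ : ℝ) : ℝ :=
  sSup ((fun z => |ψ (tins τ (τ • z))|) '' Dreg 1)

lemma continuous_abs_tins_smul {ψ : (Fin 4 → ℝ) → ℝ} (hψ : Continuous ψ) :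
    Continuous fun p : ℝ × (Fin 3 → ℝ) => |ψ (tins p.1 (p.1 • p.2))| := by
  have : Continuous fun p : ℝ × (Fin 3 → ℝ) => tins p.1 (p.1 • p.2) := by
    refine continuous_pi fun α => ?_
    refine Fin.cases ?_ (fun i => ?_) α
    · exact continuous_fst
    · simp only [tins, Fin.cons_succ, Pi.smul_apply, smul_eq_mul]
      fun_prop
  exact (hψ.comp this).abs

lemma continuous_dsup {ψ : (Fin 4 → ℝ) → ℝ} (hψ : Continuous ψ) : Continuous (dsup ψ) :=
  (isCompact_Dreg 1).continuous_sSup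
    (f := fun τ z => |ψ (tins τ (τ • z))|) (continuous_abs_tins_smul hψ)

lemma dsup_nonneg (ψ : (Fin 4 → ℝ) → ℝ) (τ : ℝ) : 0 ≤ dsup ψ τ :=
  Real.sSup_nonneg (by rintro _ ⟨z, -, rfl⟩; exact abs_nonneg _)

lemma abs_le_dsup {ψ : (Fin 4 → ℝ) → ℝ} (hψ : Continuous ψ) {y : Fin 4 → ℝ} (hy : 0 < y 0)
    (h1 : y 0 / 2 ≤ rad y) (h2 : rad y ≤ 2 * y 0) : |ψ y| ≤ dsup ψ (y 0) := by
  have hc : Continuous fun z : Fin 3 → ℝ => |ψ (tins (y 0) (y 0 • z))| :=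
    (continuous_abs_tins_smul hψ).comp (Continuous.prodMk_right (y 0))
  refine le_csSup ((isCompact_Dreg 1).image hc).bddAbove
    ⟨(y 0)⁻¹ • sp y, inv_smul_mem_Dreg hy ⟨h1, h2⟩, ?_⟩
  simp only [smul_inv_smul₀ hy.ne', tins_sp]

lemma ofReal_dsup_le {ψ : (Fin 4 → ℝ) → ℝ} (hψ : Continuous ψ) {τ : ℝ} (hτ : 0 ≤ τ) :
    ENNReal.ofReal (dsup ψ τ) ≤ esupD ψ τ := by
  have hc : Continuous fun z : Fin 3 → ℝ => |ψ (tins τ (τ • z))| :=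
    (continuous_abs_tins_smul hψ).comp (Continuous.prodMk_right τ)
  obtain ⟨z, hz, hzs⟩ := ((isCompact_Dreg 1).image hc).sSup_mem (Dreg_one_nonempty.image _)
  rw [dsup, ← hzs]
  exact le_iSup₂_of_le (τ • z) (smul_mem_Dreg hτ hz) le_rfl

/-- `∑_{|I|=1}` of the suprema of `|Z^I ψ|` -/
def dsup₁ (ψ : (Fin 4 → ℝ) → ℝ) (τ : ℝ) : ℝ := ∑ i : Fin 11, dsup (Zap (ZV i) ψ) τ

/-- `∑_{|I|=2}` of the suprema of `|Z^I ψ|` -/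
def dsup₂ (ψ : (Fin 4 → ℝ) → ℝ) (τ : ℝ) : ℝ := ∑ i : Fin 11, dsup₁ (Zap (ZV i) ψ) τ

/-- `∑_{|I|=3}` of the suprema of `|Z^I ψ|` -/
def dsup₃ (ψ : (Fin 4 → ℝ) → ℝ) (τ : ℝ) : ℝ := ∑ i : Fin 11, dsup₂ (Zap (ZV i) ψ) τ

lemma dsup₁_nonneg (ψ : (Fin 4 → ℝ) → ℝ) (τ : ℝ) : 0 ≤ dsup₁ ψ τ :=
  Finset.sum_nonneg fun _ _ => dsup_nonneg _ _

lemma dsup₂_nonneg (ψ : (Fin 4 → ℝ) → ℝ) (τ : ℝ) : 0 ≤ dsup₂ ψ τ :=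
  Finset.sum_nonneg fun _ _ => dsup₁_nonneg _ _

lemma dsup₃_nonneg (ψ : (Fin 4 → ℝ) → ℝ) (τ : ℝ) : 0 ≤ dsup₃ ψ τ :=
  Finset.sum_nonneg fun _ _ => dsup₂_nonneg _ _

lemma continuous_dsup₁ {ψ : (Fin 4 → ℝ) → ℝ} (hψ : ContDiff ℝ (⊤ : ℕ∞) ψ) :
    Continuous (dsup₁ ψ) :=
  continuous_finsetSum _ fun i _ => continuous_dsup (contDiff_Zap hψ i).continuous

lemma continuous_dsup₂ {ψ : (Fin 4 → ℝ) → ℝ} (hψ : ContDiff ℝ (⊤ : ℕ∞) ψ) :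
    Continuous (dsup₂ ψ) :=
  continuous_finsetSum _ fun i _ => continuous_dsup₁ (contDiff_Zap hψ i)

lemma continuous_dsup₃ {ψ : (Fin 4 → ℝ) → ℝ} (hψ : ContDiff ℝ (⊤ : ℕ∞) ψ) :
    Continuous (dsup₃ ψ) :=
  continuous_finsetSum _ fun i _ => continuous_dsup₂ (contDiff_Zap hψ i)

lemma zabs₁_le_dsup₁ {ψ : (Fin 4 → ℝ) → ℝ} (hψ : ContDiff ℝ (⊤ : ℕ∞) ψ) {y : Fin 4 → ℝ}
    (hy : 0 < y 0) (h1 : y 0 / 2 ≤ rad y) (h2 : rad y ≤ 2 * y 0) :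
    zabs₁ ψ y ≤ dsup₁ ψ (y 0) :=
  Finset.sum_le_sum fun i _ => abs_le_dsup (contDiff_Zap hψ i).continuous hy h1 h2

lemma zabs₂_le_dsup₂ {ψ : (Fin 4 → ℝ) → ℝ} (hψ : ContDiff ℝ (⊤ : ℕ∞) ψ) {y : Fin 4 → ℝ}
    (hy : 0 < y 0) (h1 : y 0 / 2 ≤ rad y) (h2 : rad y ≤ 2 * y 0) :
    zabs₂ ψ y ≤ dsup₂ ψ (y 0) :=
  Finset.sum_le_sum fun i _ => zabs₁_le_dsup₁ (contDiff_Zap hψ i) hy h1 h2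

lemma zabs₃_le_dsup₃ {ψ : (Fin 4 → ℝ) → ℝ} (hψ : ContDiff ℝ (⊤ : ℕ∞) ψ) {y : Fin 4 → ℝ}
    (hy : 0 < y 0) (h1 : y 0 / 2 ≤ rad y) (h2 : rad y ≤ 2 * y 0) :
    zabs₃ ψ y ≤ dsup₃ ψ (y 0) :=
  Finset.sum_le_sum fun i _ => zabs₂_le_dsup₂ (contDiff_Zap hψ i) hy h1 h2

lemma ofReal_dsup₁_le {ψ : (Fin 4 → ℝ) → ℝ} (hψ : ContDiff ℝ (⊤ : ℕ∞) ψ) {τ : ℝ}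
    (hτ : 0 ≤ τ) : ENNReal.ofReal (dsup₁ ψ τ) ≤ ∑ i : Fin 11, esupD (Zap (ZV i) ψ) τ := by
  rw [dsup₁, ENNReal.ofReal_sum_of_nonneg fun i _ => dsup_nonneg _ _]
  exact Finset.sum_le_sum fun i _ => ofReal_dsup_le (contDiff_Zap hψ i).continuous hτ

lemma ofReal_dsup₂_le {ψ : (Fin 4 → ℝ) → ℝ} (hψ : ContDiff ℝ (⊤ : ℕ∞) ψ) {τ : ℝ}
    (hτ : 0 ≤ τ) : ENNReal.ofReal (dsup₂ ψ τ)
      ≤ ∑ i : Fin 11, ∑ j : Fin 11, esupD (Zap (ZV i) (Zap (ZV j) ψ)) τ := by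
  rw [dsup₂, ENNReal.ofReal_sum_of_nonneg fun i _ => dsup₁_nonneg _ _, Finset.sum_comm]
  exact Finset.sum_le_sum fun j _ => ofReal_dsup₁_le (contDiff_Zap hψ j) hτ

lemma ofReal_dsup₃_le {ψ : (Fin 4 → ℝ) → ℝ} (hψ : ContDiff ℝ (⊤ : ℕ∞) ψ) {τ : ℝ}
    (hτ : 0 ≤ τ) : ENNReal.ofReal (dsup₃ ψ τ)
      ≤ ∑ i : Fin 11, ∑ j : Fin 11, ∑ k : Fin 11,
          esupD (Zap (ZV i) (Zap (ZV j) (Zap (ZV k) ψ))) τ := by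
  rw [dsup₃, ENNReal.ofReal_sum_of_nonneg fun i _ => dsup₂_nonneg _ _]
  refine (Finset.sum_le_sum fun k _ => ofReal_dsup₂_le (contDiff_Zap hψ k) hτ).trans_eq ?_
  rw [Finset.sum_comm]
  exact Finset.sum_congr rfl fun i _ => Finset.sum_comm

/-- The source term of the transport equation, bounded on each time slice. -/
def source (φ F : (Fin 4 → ℝ) → ℝ) (τ : ℝ) : ℝ :=
  (1 + |τ|) * (dsup F τ + dsup₁ F τ)
    + (1 + |τ|)⁻¹ * (dsup φ τ + dsup₁ φ τ + dsup₂ φ τ + dsup₃ φ τ)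

lemma source_nonneg (φ F : (Fin 4 → ℝ) → ℝ) (τ : ℝ) : 0 ≤ source φ F τ := by
  have h1 := dsup_nonneg F τ
  have h2 := dsup₁_nonneg F τ
  have h3 := dsup_nonneg φ τ
  have h4 := dsup₁_nonneg φ τ
  have h5 := dsup₂_nonneg φ τ
  have h6 := dsup₃_nonneg φ τ
  unfold source
  positivity

lemma continuous_source {φ F : (Fin 4 → ℝ) → ℝ} (hφ : ContDiff ℝ (⊤ : ℕ∞) φ)
    (hF : ContDiff ℝ (⊤ : ℕ∞) F) : Continuous (source φ F) := by
  have h1 := continuous_dsup hF.continuous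
  have h2 := continuous_dsup₁ hF
  have h3 := continuous_dsup hφ.continuous
  have h4 := continuous_dsup₁ hφ
  have h5 := continuous_dsup₂ hφ
  have h6 := continuous_dsup₃ hφ
  have h7 : Continuous fun τ : ℝ => (1 + |τ|)⁻¹ :=
    (continuous_const.add continuous_abs).inv₀ fun τ =>
      (by positivity : (0 : ℝ) < 1 + |τ|).ne'
  unfold source
  fun_prop

lemma le_source {φ F : (Fin 4 → ℝ) → ℝ} (hφ : ContDiff ℝ (⊤ : ℕ∞) φ)
    (hF : ContDiff ℝ (⊤ : ℕ∞) F) {y : Fin 4 → ℝ}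
    (hy : 0 < y 0) (h1 : y 0 / 2 ≤ rad y) (h2 : rad y ≤ 2 * y 0) :
    (1 + y 0) * (|F y| + zabs₁ F y)
      + (1 + y 0)⁻¹ * (|φ y| + zabs₁ φ y + zabs₂ φ y + zabs₃ φ y) ≤ source φ F (y 0) := by
  have a1 := abs_le_dsup hF.continuous hy h1 h2
  have a2 := zabs₁_le_dsup₁ hF hy h1 h2
  have a3 := abs_le_dsup hφ.continuous hy h1 h2
  have a4 := zabs₁_le_dsup₁ hφ hy h1 h2
  have a5 := zabs₂_le_dsup₂ hφ hy h1 h2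
  have a6 := zabs₃_le_dsup₃ hφ hy h1 h2
  unfold source
  rw [abs_of_pos hy]
  gcongr

lemma ofReal_source_le {φ F : (Fin 4 → ℝ) → ℝ} (hφ : ContDiff ℝ (⊤ : ℕ∞) φ)
    (hF : ContDiff ℝ (⊤ : ℕ∞) F) {τ : ℝ} (hτ : 0 ≤ τ) :
    ENNReal.ofReal (source φ F τ) ≤ ENNReal.ofReal (1 + τ) *
        (esupD F τ + ∑ i : Fin 11, esupD (Zap (ZV i) F) τ)
      + ENNReal.ofReal ((1 + τ)⁻¹) *
          (esupD φ τ + (∑ i : Fin 11, esupD (Zap (ZV i) φ) τ)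
            + (∑ i : Fin 11, ∑ j : Fin 11, esupD (Zap (ZV i) (Zap (ZV j) φ)) τ)
            + ∑ i : Fin 11, ∑ j : Fin 11, ∑ k : Fin 11,
                esupD (Zap (ZV i) (Zap (ZV j) (Zap (ZV k) φ))) τ) := by
  unfold source
  rw [abs_of_nonneg hτ]
  refine ENNReal.ofReal_add_le.trans (add_le_add ?_ ?_)
  · rw [ENNReal.ofReal_mul (by positivity)]
    gcongr
    exact ENNReal.ofReal_add_le.trans
      (add_le_add (ofReal_dsup_le hF.continuous hτ) (ofReal_dsup₁_le hF hτ))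
  · rw [ENNReal.ofReal_mul (by positivity)]
    gcongr
    refine ENNReal.ofReal_add_le.trans (add_le_add ?_ (ofReal_dsup₃_le hφ hτ))
    refine ENNReal.ofReal_add_le.trans (add_le_add ?_ (ofReal_dsup₂_le hφ hτ))
    exact ENNReal.ofReal_add_le.trans
      (add_le_add (ofReal_dsup_le hφ.continuous hτ) (ofReal_dsup₁_le hφ hτ))

/-- A maximum principle for a finite family of functions in a truncated wedge about the light
cone: each member grows, along a time-increasing field, slower than the barrier `B`. -/
lemma abs_le_barrier {ι : Type*} [Finite ι] {t : ℝ} {u : ι → (Fin 4 → ℝ) → ℝ}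
    (hu : ∀ j, Continuous (u j)) {X : (Fin 4 → ℝ) → Fin 4 → ℝ} {Xu : ι → (Fin 4 → ℝ) → ℝ}
    {B B' : ℝ → ℝ} (hB : ∀ τ, 1 ≤ τ → τ ≤ t → HasDerivAt B (B' τ) τ)
    (hBpos : ∀ τ, 1 ≤ τ → τ ≤ t → 0 < B τ)
    {K : Set (Fin 4 → ℝ)}
    (hK : K = {y | 1 ≤ y 0 ∧ y 0 ≤ t ∧ y 0 / 2 ≤ rad y ∧ rad y ≤ 2 * y 0})
    (hXu : ∀ y ∈ K, ∀ j, HasDerivAt (fun s : ℝ => u j (y + s • X y)) (Xu j y) 0)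
    (hX : ∀ y ∈ K, 0 < X y 0)
    (hbd : ∀ y ∈ K, y 0 ≤ 1 ∨ rad y ≤ y 0 / 2 ∨ 2 * y 0 ≤ rad y → ∀ j, |u j y| ≤ B (y 0))
    (hgrow : ∀ y ∈ K, ∀ c : ℝ, 1 ≤ c → (∀ k, |u k y| ≤ c * B (y 0)) →
      ∀ j, |Xu j y| < c * (X y 0 * B' (y 0))) :
    ∀ y ∈ K, ∀ j, |u j y| ≤ B (y 0) := by
  have hc0 : Continuous fun y : Fin 4 → ℝ => y 0 := continuous_apply 0
  have hcr := continuous_rad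
  have hKc : IsCompact K := by
    rw [hK]
    refine Metric.isCompact_of_isClosed_isBounded ?_ ?_
    · exact (isClosed_le continuous_const hc0).inter ((isClosed_le hc0 continuous_const).inter
        ((isClosed_le (by fun_prop) hcr).inter (isClosed_le hcr (by fun_prop))))
    · refine (Metric.isBounded_closedBall (x := (0 : Fin 4 → ℝ)) (r := |2 * t|)).subset ?_
      rintro y ⟨h1, h2, -, h4⟩
      rw [mem_closedBall_zero_iff, pi_norm_le_iff_of_nonneg (abs_nonneg _)]
      intro α
      refine le_trans ?_ (le_abs_self (2 * t))
      refine Fin.cases ?_ (fun i => ?_) α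
      · rw [Real.norm_eq_abs, abs_of_nonneg (by linarith)]
        linarith
      · have : |y i.succ| ≤ rad y := abs_le_nr3 (sp y) i
        rw [Real.norm_eq_abs]
        linarith
  intro y₀ hy₀ j₀
  have hKmem : ∀ y ∈ K, 1 ≤ y 0 ∧ y 0 ≤ t := fun y hy => by
    rw [hK] at hy; exact ⟨hy.1, hy.2.1⟩
  have hBK : ∀ y ∈ K, 0 < B (y 0) := fun y hy => hBpos _ (hKmem y hy).1 (hKmem y hy).2
  have hcont : ∀ j, ContinuousOn (fun y => |u j y| / B (y 0)) K := fun j =>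
    (hu j).abs.continuousOn.div
      (fun y hy => (ContinuousAt.comp (f := fun y : Fin 4 → ℝ => y 0) (g := B)
        (hB _ (hKmem y hy).1 (hKmem y hy).2).continuousAt
        hc0.continuousAt).continuousWithinAt) fun y hy => (hBK y hy).ne'
  choose z hzK hz using fun j => hKc.exists_isMaxOn ⟨y₀, hy₀⟩ (hcont j)
  have : Nonempty ι := ⟨j₀⟩
  obtain ⟨j, hj⟩ := Finite.exists_max fun j => |u j (z j)| / B (z j 0)
  set y := z j with hy
  set c := |u j y| / B (y 0) with hc
  have hmax : ∀ w ∈ K, ∀ k, |u k w| ≤ c * B (w 0) := fun w hw k => by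
    rw [← div_le_iff₀ (hBK w hw)]
    exact (hz k hw).trans (hj k)
  have hyK : y ∈ K := hzK j
  have hyB := hBK y hyK
  by_contra hcon
  have hc1 : 1 < c := by
    have h1 := hmax y₀ hy₀ j₀
    by_contra h
    have h2 := mul_le_mul_of_nonneg_right (not_lt.1 h) (hBK y₀ hy₀).le
    linarith
  have h_interior : ¬ (y 0 ≤ 1 ∨ rad y ≤ y 0 / 2 ∨ 2 * y 0 ≤ rad y) := fun h => by
    have := hbd y hyK h j
    rw [hc, lt_div_iff₀ hyB] at hc1
    linarith
  push Not at h_interior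
  obtain ⟨i1, i2, i3⟩ := h_interior
  obtain ⟨σ, hσ, hσu⟩ : ∃ σ : ℝ, |σ| = 1 ∧ σ * u j y = |u j y| := by
    rcases le_total 0 (u j y) with h | h
    · exact ⟨1, by simp, by rw [abs_of_nonneg h, one_mul]⟩
    · exact ⟨-1, by simp, by rw [abs_of_nonpos h]; ring⟩
  set w : ℝ → ℝ := fun s => σ * u j (y + s • X y) - c * B ((y + s • X y) 0) with hw
  have hw0 : w 0 = 0 := by
    simp only [hw, zero_smul, add_zero, hσu, hc]
    rw [div_mul_cancel₀ _ hyB.ne', sub_self]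
  have hwd : HasDerivAt w (σ * Xu j y - c * (X y 0 * B' (y 0))) 0 := by
    have h1 : HasDerivAt (fun s : ℝ => (y + s • X y) 0) (X y 0) 0 := by
      simpa using ((hasDerivAt_id (0 : ℝ)).mul_const (X y 0)).const_add (y 0)
    have h2 : HasDerivAt B (B' (y 0)) ((y + (0 : ℝ) • X y) 0) := by
      simpa using hB _ (hKmem y hyK).1 (hKmem y hyK).2
    have h3 := h2.comp (0 : ℝ) h1
    refine (((hXu y hyK j).const_mul σ).sub (h3.const_mul c)).congr_deriv ?_
    ring
  have hneg : σ * Xu j y - c * (X y 0 * B' (y 0)) < 0 := by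
    have h1 := hgrow y hyK c hc1.le (hmax y hyK) j
    have h2 := le_abs_self (σ * Xu j y)
    rw [abs_mul, hσ, one_mul] at h2
    linarith
  have hl : Continuous fun s : ℝ => y + s • X y := by fun_prop
  have hyl : y + (0 : ℝ) • X y = y := by simp
  have hyK' := hyK
  rw [hK] at hyK'
  have hev : ∀ᶠ s in nhdsWithin (0 : ℝ) (Set.Iio 0), w s ≤ 0 := by
    have e1 : ∀ᶠ s in nhds (0 : ℝ), 1 < (y + s • X y) 0 :=
      (hc0.comp hl).continuousAt.eventually (lt_mem_nhds (by simpa using i1))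
    have e2 : ∀ᶠ s in nhds (0 : ℝ), (y + s • X y) 0 / 2 < rad (y + s • X y) :=
      (((hc0.comp hl).div_const 2).continuousAt).eventually_lt (hcr.comp hl).continuousAt
        (by simpa using i2)
    have e3 : ∀ᶠ s in nhds (0 : ℝ), rad (y + s • X y) < 2 * (y + s • X y) 0 :=
      (hcr.comp hl).continuousAt.eventually_lt
        (continuous_const.mul (hc0.comp hl)).continuousAt (by simpa using i3)
    filter_upwards [nhdsWithin_le_nhds e1, nhdsWithin_le_nhds e2, nhdsWithin_le_nhds e3,
      self_mem_nhdsWithin] with s s1 s2 s3 s4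
    have hmem : y + s • X y ∈ K := by
      rw [hK]
      refine ⟨s1.le, ?_, s2.le, s3.le⟩
      have : s * X y 0 ≤ 0 := mul_nonpos_of_nonpos_of_nonneg (le_of_lt s4) (hX y hyK).le
      simp only [Pi.add_apply, Pi.smul_apply, smul_eq_mul]
      linarith [hyK'.2.1]
    have h1 := hmax _ hmem j
    have h2 := le_abs_self (σ * u j (y + s • X y))
    rw [abs_mul, hσ, one_mul] at h2
    simp only [hw]
    linarith
  have hslope := (hasDerivWithinAt_iff_tendsto_slope' (s := Set.Iio (0 : ℝ))
    (by simp)).1 hwd.hasDerivWithinAt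
  have hfalse : ∀ᶠ s in nhdsWithin (0 : ℝ) (Set.Iio 0), False := by
    filter_upwards [hev, hslope.eventually (gt_mem_nhds hneg), self_mem_nhdsWithin]
      with s s1 s2 s3
    rw [slope_def_field, hw0, sub_zero, sub_zero] at s2
    exact absurd s2 (not_lt.2 (div_nonneg_of_nonpos s1 (le_of_lt s3)))
  simpa using hfalse.exists

lemma abs_ufun_le_of_outside (ψ : (Fin 4 → ℝ) → ℝ) {y : Fin 4 → ℝ} (hy : 0 ≤ y 0)
    (h : y 0 ≤ 1 ∨ rad y ≤ y 0 / 2 ∨ 2 * y 0 ≤ rad y) :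
    |ufun ψ y| ≤ 24 * zabs₁ ψ y := by
  have hr := rad_nonneg y
  have hp : ∀ α, rad y * |pd ψ α y| ≤ 6 * zabs₁ ψ y := fun α => by
    refine le_trans ?_ (mul_abs_le_zsum_of_outside α y (fun μ => pd ψ μ y) hy h)
    gcongr
    linarith
  have h0 : |rad y * pd ψ 0 y| ≤ 6 * zabs₁ ψ y := by
    rw [abs_mul, abs_of_nonneg hr]; exact hp 0
  have hi : |∑ i : Fin 3, y i.succ * pd ψ i.succ y| ≤ ∑ _i : Fin 3, 6 * zabs₁ ψ y := by
    refine (Finset.abs_sum_le_sum_abs _ _).trans (Finset.sum_le_sum fun i _ => ?_)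
    rw [abs_mul]
    have : |y i.succ| ≤ rad y := abs_le_nr3 (sp y) i
    exact (mul_le_mul_of_nonneg_right this (abs_nonneg _)).trans (hp _)
  simp only [Finset.sum_const, Finset.card_univ, Fintype.card_fin, nsmul_eq_mul] at hi
  have := abs_sub (rad y * pd ψ 0 y) (∑ i : Fin 3, y i.succ * pd ψ i.succ y)
  push_cast at hi
  unfold ufun
  linarith

lemma zabs₁_fam_le (φ : (Fin 4 → ℝ) → ℝ) (y : Fin 4 → ℝ) (j : Option (Fin 11)) :
    zabs₁ (fam φ j) y ≤ zabs₁ φ y + zabs₂ φ y := by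
  rw [← sum_zabs₁_fam]
  exact Finset.single_le_sum (f := fun j => zabs₁ (fam φ j) y) (fun _ _ => zabs₁_nonneg _ _)
    (Finset.mem_univ j)

lemma abs_ufun_fam_le {φ F : (Fin 4 → ℝ) → ℝ} (hφ : ContDiff ℝ (⊤ : ℕ∞) φ)
    (hF : ContDiff ℝ (⊤ : ℕ∞) F) {ε T : ℝ} (hε : 0 < ε) (hε1 : ε ≤ 1)
    {H : (Fin 4 → ℝ) → Fin 4 → Fin 4 → ℝ}
    (hH : ∀ α β, ContDiff ℝ (⊤ : ℕ∞) (fun y => H y α β))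
    (hs : ∀ y α β, H y α β = H y β α)
    (hsol : ∀ y : Fin 4 → ℝ, 0 ≤ y 0 → y 0 ≤ T → boxg H φ y = F y)
    (hb : ∀ y : Fin 4 → ℝ, y 0 / 2 ≤ rad y → rad y ≤ 2 * y 0 →
      tnorm (H y) + (∑ i : Fin 11, tnorm (Zten (ZV i) H y)) ≤ ε / 4)
    (hLL : ∀ y : Fin 4 → ℝ, y 0 / 2 ≤ rad y → rad y ≤ 2 * y 0 → sp y ≠ 0 →
      ∀ s₁ s₂ : Fin 3 → ℝ, IsFrame (uom y) s₁ s₂ →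
        |con2 (H y) (vecLlow (uom y)) (vecLlow (uom y))|
          + (∑ i : Fin 11, |con2 (Zten (ZV i) H y) (vecLlow (uom y)) (vecLlow (uom y))|)
          + normLT (H y) (uom y) s₁ s₂
          ≤ (ε / 4) * (1 + |qq y|) / (1 + y 0 + rad y))
    {t A a : ℝ} (ht : 1 ≤ t) (htT : t ≤ T) (hA0 : 0 ≤ A) (ha : 3200000 * ε ≤ a)
    (hA : ∀ y : Fin 4 → ℝ, 1 ≤ y 0 → y 0 ≤ t →
      24 * (zabs₁ φ y + zabs₂ φ y) ≤ (1 + y 0) ^ a * A)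
    {y : Fin 4 → ℝ} (hy1 : 1 ≤ y 0) (hyt : y 0 ≤ t) (hr1 : y 0 / 2 ≤ rad y)
    (hr2 : rad y ≤ 2 * y 0) (j : Option (Fin 11)) :
    |ufun (fam φ j) y| ≤ (1 + y 0) ^ a
      * (A + 260000 * ∫ s in (1 : ℝ)..(y 0), (1 + |s|) ^ (-a) * source φ F s) := by
  set I : ℝ → ℝ := fun τ => ∫ s in (1 : ℝ)..τ, (1 + |s|) ^ (-a) * source φ F s with hI
  have hgc : Continuous fun s : ℝ => (1 + |s|) ^ (-a) * source φ F s := by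
    refine Continuous.mul ?_ (continuous_source hφ hF)
    refine (continuous_const.add continuous_abs).rpow_const fun s => Or.inl ?_
    exact (by positivity : (0 : ℝ) < 1 + |s|).ne'
  have hg0 : ∀ s : ℝ, 0 ≤ (1 + |s|) ^ (-a) * source φ F s := fun s =>
    mul_nonneg (by positivity) (source_nonneg φ F s)
  have hId : ∀ τ, HasDerivAt I ((1 + |τ|) ^ (-a) * source φ F τ) τ := fun τ =>
    intervalIntegral.integral_hasDerivAt_right (hgc.intervalIntegrable _ _)
      hgc.stronglyMeasurable.stronglyMeasurableAtFilter hgc.continuousAt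
  have hI0 : ∀ τ, 1 ≤ τ → 0 ≤ I τ := fun τ hτ =>
    intervalIntegral.integral_nonneg hτ fun s _ => hg0 s
  have hP : 0 < (1 + y 0) ^ a := by positivity
  have hy0 : 0 < y 0 := by linarith
  refine le_of_forall_pos_le_add fun e he => ?_
  set δ := e / ((1 + y 0) ^ a * y 0) with hδ
  have hδ0 : 0 < δ := by positivity
  have hδe : (1 + y 0) ^ a * (δ * y 0) = e := by
    rw [hδ]; field_simp
  set B : ℝ → ℝ := fun τ => (1 + τ) ^ a * (A + 260000 * I τ + δ * τ) with hBdef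
  set B' : ℝ → ℝ := fun τ => a / (1 + τ) * B τ + 260000 * source φ F τ + (1 + τ) ^ a * δ
    with hB'def
  have hmain : |ufun (fam φ j) y| ≤ B (y 0) := by
    have hpos : ∀ z ∈ {y : Fin 4 → ℝ | 1 ≤ y 0 ∧ y 0 ≤ t ∧ y 0 / 2 ≤ rad y ∧ rad y ≤ 2 * y 0},
        0 < rad z := by
      rintro z ⟨h1, -, h3, -⟩
      linarith
    have hsp : ∀ z : Fin 4 → ℝ, 0 < rad z → sp z ≠ 0 := fun z hz h => by
      rw [rad, h] at hz
      simp [nr3] at hz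
    have hBpos : ∀ τ, 1 ≤ τ → τ ≤ t → 0 < B τ := fun τ h1 _ => by
      have := hI0 τ h1
      have : 0 < 1 + τ := by linarith
      simp only [hBdef]
      positivity
    refine abs_le_barrier (t := t) (X := fun z => xdir (H z) (uom z))
      (Xu := fun j z => xu (H z) (fun ν μ => pd2 (fam φ j) ν μ z) z
        (fun μ => pd (fam φ j) μ z)) (B := B) (B' := B')
      (fun j => continuous_ufun (contDiff_fam hφ j)) ?_ hBpos rfl ?_ ?_ ?_ ?_ y
      ⟨hy1, hyt, hr1, hr2⟩ j
    · intro τ h1 _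
      have hτ : 0 < 1 + τ := by linarith
      have d1 : HasDerivAt (fun τ : ℝ => (1 + τ) ^ a) (a * (1 + τ) ^ (a - 1)) τ := by
        have := ((hasDerivAt_id τ).const_add 1).rpow_const (p := a) (Or.inl hτ.ne')
        simpa using this
      have d2 : HasDerivAt (fun τ : ℝ => A + 260000 * I τ + δ * τ)
          (260000 * ((1 + |τ|) ^ (-a) * source φ F τ) + δ) τ := by
        have := (((hId τ).const_mul 260000).const_add A).add ((hasDerivAt_id τ).const_mul δ)
        exact this.congr_deriv (by simp)
      refine (d1.mul d2).congr_deriv ?_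
      have e1 : (1 + τ) ^ (a - 1) = (1 + τ) ^ a / (1 + τ) := by
        rw [Real.rpow_sub_one hτ.ne']
      have e2 : (1 + τ) ^ a * (1 + |τ|) ^ (-a) = 1 := by
        rw [abs_of_nonneg (by linarith : 0 ≤ τ), Real.rpow_neg hτ.le,
          mul_inv_cancel₀ (by positivity)]
      simp only [hB'def, hBdef, e1]
      linear_combination 260000 * source φ F τ * e2
    · exact fun z hz j => hasDerivAt_line_ufun (contDiff_fam hφ j) (hpos z hz) (H z)
    · intro z hz
      have hn := hb z hz.2.2.1 hz.2.2.2
      have : tnorm (H z) ≤ 1 / 4 := by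
        linarith [Finset.sum_nonneg fun k (_ : k ∈ Finset.univ) => tnorm_nonneg (Zten (ZV k) H z)]
      linarith [half_le_xdir_zero (hpos z hz) (H z) this]
    · intro z hz hzo j
      refine (abs_ufun_le_of_outside _ (by linarith [hz.1]) hzo).trans ?_
      have h1 := hA z hz.1 hz.2.1
      have h2 := zabs₁_fam_le φ z j
      have h3 := hI0 _ hz.1
      have h4 : 0 < 1 + z 0 := by linarith [hz.1]
      have h5 : 0 < z 0 := by linarith [hz.1]
      have : (1 + z 0) ^ a * A ≤ B (z 0) := by
        simp only [hBdef]
        gcongr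
        have : 0 < δ * z 0 := by positivity
        linarith
      linarith
    · intro z hz c hc hu j
      have hn := hb z hz.2.2.1 hz.2.2.2
      have hn4 : tnorm (H z) ≤ 1 / 4 := by
        linarith [Finset.sum_nonneg fun k (_ : k ∈ Finset.univ) => tnorm_nonneg (Zten (ZV k) H z)]
      have hX := half_le_xdir_zero (hpos z hz) (H z) hn4
      have hz0 : 0 < z 0 := by linarith [hz.1]
      have h1 := abs_xu_fam_le hφ hF hε1 (by linarith) hH hs hsol hz.1 (hz.2.1.trans htT)
        hz.2.2.1 hz.2.2.2 hn (hLL z hz.2.2.1 hz.2.2.2 (hsp z (hpos z hz))) j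
      have h2 := le_source hφ hF hz0 hz.2.2.1 hz.2.2.2
      have h3 : ∑ k, |ufun (fam φ k) z| ≤ 12 * (c * B (z 0)) := by
        refine (Finset.sum_le_sum fun k _ => hu k).trans_eq ?_
        simp
      have hBz := hBpos _ hz.1 hz.2.1
      have hS := source_nonneg φ F (z 0)
      have h4 : ε / (1 + z 0) * ∑ k, |ufun (fam φ k) z| ≤ ε / (1 + z 0) * (12 * (c * B (z 0))) := by
        gcongr
      have h5 : 3200000 * (ε / (1 + z 0) * B (z 0)) ≤ a / (1 + z 0) * B (z 0) := by
        rw [← mul_assoc, ← mul_div_assoc]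
        gcongr
      have hp : 0 < (1 + z 0) ^ a * δ := by positivity
      set Q := ε / (1 + z 0) * B (z 0) with hQ
      have hQ0 : 0 < Q := by positivity
      have h6 : 3200000 * Q + 260000 * source φ F (z 0) < B' (z 0) := by
        simp only [hB'def]
        linarith
      have h7 : (1 / 2) * (3200000 * Q + 260000 * source φ F (z 0))
          < xdir (H z) (uom z) 0 * B' (z 0) := by
        calc _ < (1 / 2) * B' (z 0) := by linarith
          _ ≤ _ := mul_le_mul_of_nonneg_right hX (by linarith)
      have h8 : c * ((1 / 2) * (3200000 * Q + 260000 * source φ F (z 0)))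
          < c * (xdir (H z) (uom z) 0 * B' (z 0)) := mul_lt_mul_of_pos_left h7 (by linarith)
      refine lt_of_le_of_lt h1 (lt_of_le_of_lt ?_ h8)
      have h9 : ε / (1 + z 0) * (12 * (c * B (z 0))) = 12 * (c * Q) := by rw [hQ]; ring
      have h10 : source φ F (z 0) ≤ c * source φ F (z 0) := le_mul_of_one_le_left hS hc
      have h11 : 0 < c * Q := by positivity
      linarith
  have hfin : B (y 0) = (1 + y 0) ^ a * (A + 260000 * I (y 0)) + e := by
    simp only [hBdef]
    rw [← hδe]
    ring
  linarith

lemma dnorm_le_sum (ψ : (Fin 4 → ℝ) → ℝ) (y : Fin 4 → ℝ) : dnorm ψ y ≤ ∑ α, |pd ψ α y| := by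
  refine Real.sqrt_le_iff.2 ⟨Finset.sum_nonneg fun _ _ => abs_nonneg _, ?_⟩
  have := Finset.sum_sq_le_sq_sum_of_nonneg (s := Finset.univ) (f := fun α => |pd ψ α y|)
    fun _ _ => abs_nonneg _
  simpa using this

lemma dnorm_add_sum_le (φ : (Fin 4 → ℝ) → ℝ) (y : Fin 4 → ℝ) :
    dnorm φ y + ∑ i : Fin 11, dnorm (Zap (ZV i) φ) y ≤ ∑ j, ∑ α, |pd (fam φ j) α y| :=
  (add_le_add (dnorm_le_sum _ _) (Finset.sum_le_sum fun _ _ => dnorm_le_sum _ _)).trans_eq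
    (Fintype.sum_option fun j => ∑ α, |pd (fam φ j) α y|).symm

lemma ofReal_abs_le_esup (ψ : (Fin 4 → ℝ) → ℝ) (y : Fin 4 → ℝ) :
    ENNReal.ofReal |ψ y| ≤ esup ψ (y 0) := by
  conv_lhs => rw [← tins_sp y]
  exact le_iSup (fun x => ENNReal.ofReal |ψ (tins (y 0) x)|) (sp y)

lemma ofReal_zabs₁_le (φ : (Fin 4 → ℝ) → ℝ) (y : Fin 4 → ℝ) :
    ENNReal.ofReal (zabs₁ φ y) ≤ ∑ i : Fin 11, esup (Zap (ZV i) φ) (y 0) := by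
  rw [zabs₁, ENNReal.ofReal_sum_of_nonneg fun i _ => abs_nonneg _]
  exact Finset.sum_le_sum fun i _ => ofReal_abs_le_esup _ y

lemma ofReal_zabs₂_le (φ : (Fin 4 → ℝ) → ℝ) (y : Fin 4 → ℝ) :
    ENNReal.ofReal (zabs₂ φ y)
      ≤ ∑ i : Fin 11, ∑ j : Fin 11, esup (Zap (ZV i) (Zap (ZV j) φ)) (y 0) := by
  rw [zabs₂, ENNReal.ofReal_sum_of_nonneg fun i _ => zabs₁_nonneg _ _, Finset.sum_comm]
  exact Finset.sum_le_sum fun j _ => ofReal_zabs₁_le _ y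

lemma ofReal_zabs_add_le (φ : (Fin 4 → ℝ) → ℝ) (y : Fin 4 → ℝ) :
    ENNReal.ofReal (zabs₁ φ y + zabs₂ φ y)
      ≤ esup φ (y 0) + (∑ i : Fin 11, esup (Zap (ZV i) φ) (y 0))
        + ∑ i : Fin 11, ∑ j : Fin 11, esup (Zap (ZV i) (Zap (ZV j) φ)) (y 0) :=
  ENNReal.ofReal_add_le.trans (add_le_add
    ((ofReal_zabs₁_le φ y).trans le_add_self) (ofReal_zabs₂_le φ y))

lemma sum_le_of_outside (φ : (Fin 4 → ℝ) → ℝ) {y : Fin 4 → ℝ} (hy : 0 ≤ y 0)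
    (h : y 0 ≤ 1 ∨ rad y ≤ y 0 / 2 ∨ 2 * y 0 ≤ rad y) :
    (1 + y 0 + rad y) * ∑ j, ∑ α, |pd (fam φ j) α y| ≤ 24 * (zabs₁ φ y + zabs₂ φ y) := by
  rw [Finset.mul_sum, ← sum_zabs₁_fam, Finset.mul_sum]
  refine Finset.sum_le_sum fun j _ => ?_
  rw [Finset.mul_sum]
  refine (Finset.sum_le_sum fun α _ =>
    mul_abs_le_zsum_of_outside α y (fun μ => pd (fam φ j) μ y) hy h).trans_eq ?_
  simp only [Finset.sum_const, Finset.card_univ, Fintype.card_fin, nsmul_eq_mul]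
  change _ * (6 * zabs₁ (fam φ j) y) = _
  push_cast
  ring

lemma sum_le_of_inside (φ : (Fin 4 → ℝ) → ℝ) {y : Fin 4 → ℝ} (hy : 1 ≤ y 0)
    (h : y 0 / 2 ≤ rad y) {b : ℝ} (hb : ∀ j, |ufun (fam φ j) y| ≤ b) :
    (1 + y 0 + rad y) * ∑ j, ∑ α, |pd (fam φ j) α y|
      ≤ 240 * b + 40 * (zabs₁ φ y + zabs₂ φ y) := by
  have hr : 0 < rad y := by linarith
  have hS : rad y * ∑ j, ∑ α, |pd (fam φ j) α y|
      ≤ ∑ j, ∑ _α : Fin 4, (b + 2 * zabs₁ (fam φ j) y) := by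
    rw [Finset.mul_sum]
    refine Finset.sum_le_sum fun j _ => ?_
    rw [Finset.mul_sum]
    refine Finset.sum_le_sum fun α _ => (rad_mul_abs_pd_le _ (by linarith) hr α).trans ?_
    linarith [hb j]
  have e : ∑ j, ∑ _α : Fin 4, (b + 2 * zabs₁ (fam φ j) y)
      = 48 * b + 8 * (zabs₁ φ y + zabs₂ φ y) := by
    simp only [Finset.sum_const, Finset.card_univ, Fintype.card_fin, nsmul_eq_mul]
    rw [← Finset.mul_sum, Finset.sum_add_distrib, ← Finset.mul_sum, sum_zabs₁_fam]
    simp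
    ring
  have h0 : 0 ≤ ∑ j, ∑ α, |pd (fam φ j) α y| :=
    Finset.sum_nonneg fun _ _ => Finset.sum_nonneg fun _ _ => abs_nonneg _
  have h5 : (1 + y 0 + rad y) * ∑ j, ∑ α, |pd (fam φ j) α y|
      ≤ (5 * rad y) * ∑ j, ∑ α, |pd (fam φ j) α y| := by
    gcongr
    linarith
  linarith

lemma ofReal_integral_source_le {φ F : (Fin 4 → ℝ) → ℝ} (hφ : ContDiff ℝ (⊤ : ℕ∞) φ)
    (hF : ContDiff ℝ (⊤ : ℕ∞) F) {t : ℝ} (ht : 1 ≤ t) (a : ℝ) :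
    ENNReal.ofReal ((1 + t) ^ a * ∫ s in (1 : ℝ)..t, (1 + |s|) ^ (-a) * source φ F s)
      ≤ ∫⁻ τ in Set.Icc (0:ℝ) t,
          ENNReal.ofReal (((1 + t) / (1 + τ)) ^ a) *
            (ENNReal.ofReal (1 + τ) *
                (esupD F τ + ∑ i : Fin 11, esupD (Zap (ZV i) F) τ)
              + ENNReal.ofReal ((1 + τ)⁻¹) *
                  (esupD φ τ + (∑ i : Fin 11, esupD (Zap (ZV i) φ) τ)
                    + (∑ i : Fin 11, ∑ j : Fin 11,
                        esupD (Zap (ZV i) (Zap (ZV j) φ)) τ)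
                    + ∑ i : Fin 11, ∑ j : Fin 11, ∑ k : Fin 11,
                        esupD (Zap (ZV i) (Zap (ZV j) (Zap (ZV k) φ))) τ)) := by
  have hgc : Continuous fun s : ℝ => (1 + t) ^ a * ((1 + |s|) ^ (-a) * source φ F s) := by
    refine continuous_const.mul (Continuous.mul ?_ (continuous_source hφ hF))
    refine (continuous_const.add continuous_abs).rpow_const fun s => Or.inl ?_
    exact (by positivity : (0 : ℝ) < 1 + |s|).ne'
  have hg0 : ∀ s : ℝ, 0 ≤ (1 + t) ^ a * ((1 + |s|) ^ (-a) * source φ F s) := fun s => by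
    have := source_nonneg φ F s
    positivity
  rw [← intervalIntegral.integral_const_mul, intervalIntegral.integral_of_le ht,
    ofReal_integral_eq_lintegral_ofReal (hgc.integrableOn_Ioc) (.of_forall hg0)]
  refine le_trans (setLIntegral_mono' measurableSet_Ioc fun τ hτ => ?_)
    (lintegral_mono_set (Set.Ioc_subset_Icc_self.trans (Set.Icc_subset_Icc_left zero_le_one)))
  have hτ0 : 0 ≤ τ := by linarith [hτ.1]
  rw [← mul_assoc, ENNReal.ofReal_mul (by positivity)]
  have e : (1 + t) ^ a * (1 + |τ|) ^ (-a) = ((1 + t) / (1 + τ)) ^ a := by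
    rw [abs_of_nonneg hτ0, Real.div_rpow (by linarith) (by linarith),
      Real.rpow_neg (by linarith), div_eq_mul_inv]
  rw [e]
  gcongr
  exact ofReal_source_le hφ hF hτ0

/-- Lemma 10.2: L∞–L∞ decay estimate for first vector-field derivatives. -/
theorem decay_estimate_first_vectorfield_derivatives :
    ∃ C : ℝ, 0 < C ∧
      ∀ (ε' : ℝ), 0 < ε' → ε' ≤ 1 →
      ∀ (T : ℝ) (H : (Fin 4 → ℝ) → Fin 4 → Fin 4 → ℝ) (φ F : (Fin 4 → ℝ) → ℝ),
        ContDiff ℝ (⊤ : ℕ∞) φ → ContDiff ℝ (⊤ : ℕ∞) F →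
        (∀ α β, ContDiff ℝ (⊤ : ℕ∞) (fun y => H y α β)) →
        (∀ y α β, H y α β = H y β α) →
        -- φ solves the reduced wave equation g^{αβ}∂_α∂_βφ = F on [0,T] × ℝ³
        (∀ y : Fin 4 → ℝ, 0 ≤ y 0 → y 0 ≤ T → boxg H φ y = F y) →
        -- Σ_{|I|≤1}|Z^I H| ≤ ε'/4 on the region t/2 ≤ |x| ≤ 2t
        (∀ y : Fin 4 → ℝ, y 0 / 2 ≤ rad y → rad y ≤ 2 * y 0 →
          tnorm (H y) + (∑ i : Fin 11, tnorm (Zten (ZV i) H y)) ≤ ε' / 4) →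
        -- Σ_{|I|≤1}|Z^I H|_{LL} + |H|_{L𝒯} ≤ (ε'/4)(1+|q|)/(1+t+|x|) on that region
        (∀ y : Fin 4 → ℝ, y 0 / 2 ≤ rad y → rad y ≤ 2 * y 0 → sp y ≠ 0 →
          ∀ s₁ s₂ : Fin 3 → ℝ, IsFrame (uom y) s₁ s₂ →
            |con2 (H y) (vecLlow (uom y)) (vecLlow (uom y))|
              + (∑ i : Fin 11,
                  |con2 (Zten (ZV i) H y) (vecLlow (uom y)) (vecLlow (uom y))|)
              + normLT (H y) (uom y) s₁ s₂
              ≤ (ε' / 4) * (1 + |qq y|) / (1 + y 0 + rad y)) →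
        ∀ t : ℝ, 0 ≤ t → t ≤ T → ∀ x : Fin 3 → ℝ,
          ENNReal.ofReal ((1 + t + nr3 x) *
              (dnorm φ (tins t x) + ∑ i : Fin 11, dnorm (Zap (ZV i) φ) (tins t x)))
            ≤ ENNReal.ofReal C *
                (⨆ τ ∈ Set.Icc (0:ℝ) t,
                  ENNReal.ofReal (((1 + t) / (1 + τ)) ^ (C * ε')) *
                    (esup φ τ + (∑ i : Fin 11, esup (Zap (ZV i) φ) τ)
                      + ∑ i : Fin 11, ∑ j : Fin 11, esup (Zap (ZV i) (Zap (ZV j) φ)) τ))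
              + ENNReal.ofReal C *
                ∫⁻ τ in Set.Icc (0:ℝ) t,
                  ENNReal.ofReal (((1 + t) / (1 + τ)) ^ (C * ε')) *
                    (ENNReal.ofReal (1 + τ) *
                        (esupD F τ + ∑ i : Fin 11, esupD (Zap (ZV i) F) τ)
                      + ENNReal.ofReal ((1 + τ)⁻¹) *
                          (esupD φ τ + (∑ i : Fin 11, esupD (Zap (ZV i) φ) τ)
                            + (∑ i : Fin 11, ∑ j : Fin 11,
                                esupD (Zap (ZV i) (Zap (ZV j) φ)) τ)
                            + ∑ i : Fin 11, ∑ j : Fin 11, ∑ k : Fin 11,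
                                esupD (Zap (ZV i) (Zap (ZV j) (Zap (ZV k) φ))) τ)) := by
  refine ⟨100000000, by norm_num, ?_⟩
  intro ε hε hε1 T H φ F hφ hF hH hs hsol hb hLL t ht0 htT x
  set a : ℝ := 100000000 * ε with ha
  set M : ℝ≥0∞ := ⨆ τ ∈ Set.Icc (0:ℝ) t,
    ENNReal.ofReal (((1 + t) / (1 + τ)) ^ a) *
      (esup φ τ + (∑ i : Fin 11, esup (Zap (ZV i) φ) τ)
        + ∑ i : Fin 11, ∑ j : Fin 11, esup (Zap (ZV i) (Zap (ZV j) φ)) τ) with hM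
  set y : Fin 4 → ℝ := tins t x with hy
  have hy0 : y 0 = t := rfl
  have hrad : rad y = nr3 x := rad_tins t x
  have hzM : ∀ z : Fin 4 → ℝ, 0 ≤ z 0 → z 0 ≤ t →
      ENNReal.ofReal (((1 + t) / (1 + z 0)) ^ a * (zabs₁ φ z + zabs₂ φ z)) ≤ M := by
    intro z hz0 hzt
    rw [ENNReal.ofReal_mul (by positivity)]
    refine le_trans ?_ (le_iSup₂_of_le (z 0) ⟨hz0, hzt⟩ le_rfl)
    gcongr
    exact ofReal_zabs_add_le φ z
  have hyM : ENNReal.ofReal (zabs₁ φ y + zabs₂ φ y) ≤ M := by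
    have h := hzM y ht0 le_rfl
    rwa [hy0, div_self (by linarith), Real.one_rpow, one_mul] at h
  have hLHS : ENNReal.ofReal ((1 + t + nr3 x) *
        (dnorm φ y + ∑ i : Fin 11, dnorm (Zap (ZV i) φ) y))
      ≤ ENNReal.ofReal ((1 + y 0 + rad y) * ∑ j, ∑ α, |pd (fam φ j) α y|) := by
    rw [hy0, hrad]
    refine ENNReal.ofReal_le_ofReal (mul_le_mul_of_nonneg_left (dnorm_add_sum_le φ y) ?_)
    have := rad_nonneg y
    rw [hrad] at this
    linarith
  refine hLHS.trans ?_
  by_cases hout : y 0 ≤ 1 ∨ rad y ≤ y 0 / 2 ∨ 2 * y 0 ≤ rad y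
  · refine le_trans ?_ le_self_add
    calc ENNReal.ofReal ((1 + y 0 + rad y) * ∑ j, ∑ α, |pd (fam φ j) α y|)
        ≤ ENNReal.ofReal (100000000 * (zabs₁ φ y + zabs₂ φ y)) := by
          refine ENNReal.ofReal_le_ofReal ((sum_le_of_outside φ ht0 hout).trans ?_)
          linarith [zabs₁_nonneg φ y, zabs₂_nonneg φ y]
      _ = ENNReal.ofReal 100000000 * ENNReal.ofReal (zabs₁ φ y + zabs₂ φ y) :=
          ENNReal.ofReal_mul (by norm_num)
      _ ≤ _ := by gcongr
  · push Not at hout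
    obtain ⟨h1, h2, h3⟩ := hout
    have ht1 : 1 ≤ t := h1.le
    by_cases hMtop : M = ⊤
    · rw [hMtop, ENNReal.mul_top (by simp), top_add]
      exact le_top
    set m := M.toReal with hm
    have hmM : ENNReal.ofReal m = M := ENNReal.ofReal_toReal hMtop
    have hm0 : 0 ≤ m := ENNReal.toReal_nonneg
    have hP : 0 < (1 + t) ^ a := by positivity
    set J := (1 + t) ^ a * ∫ s in (1 : ℝ)..t, (1 + |s|) ^ (-a) * source φ F s with hJ
    have hJ0 : 0 ≤ J := mul_nonneg hP.le (intervalIntegral.integral_nonneg ht1 fun s _ =>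
      mul_nonneg (by positivity) (source_nonneg φ F s))
    have hA : ∀ z : Fin 4 → ℝ, 1 ≤ z 0 → z 0 ≤ t →
        24 * (zabs₁ φ z + zabs₂ φ z) ≤ (1 + z 0) ^ a * (24 * m / (1 + t) ^ a) := by
      intro z hz1 hzt
      have hz := hzM z (by linarith) hzt
      rw [← hmM, ENNReal.ofReal_le_ofReal_iff hm0,
        Real.div_rpow (by linarith) (by linarith)] at hz
      have hQ : 0 < (1 + z 0) ^ a := Real.rpow_pos_of_pos (by linarith) a
      rw [div_mul_eq_mul_div, div_le_iff₀ hQ] at hz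
      rw [← mul_div_assoc, le_div_iff₀ hP]
      linarith
    have hu : ∀ j, |ufun (fam φ j) y| ≤ 24 * m + 260000 * J := fun j => by
      refine (abs_ufun_fam_le hφ hF hε hε1 hH hs hsol hb hLL ht1 htT
        (A := 24 * m / (1 + t) ^ a) (by positivity) (by linarith) hA h1.le le_rfl
        h2.le h3.le j).trans_eq ?_
      rw [hy0, mul_add, mul_div_cancel₀ _ hP.ne', hJ]
      ring
    have hzm : zabs₁ φ y + zabs₂ φ y ≤ m := by
      rwa [← hmM, ENNReal.ofReal_le_ofReal_iff hm0] at hyM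
    calc ENNReal.ofReal ((1 + y 0 + rad y) * ∑ j, ∑ α, |pd (fam φ j) α y|)
        ≤ ENNReal.ofReal (100000000 * m + 100000000 * J) := by
          refine ENNReal.ofReal_le_ofReal ((sum_le_of_inside φ h1.le h2.le hu).trans ?_)
          linarith
      _ = ENNReal.ofReal 100000000 * M + ENNReal.ofReal 100000000 * ENNReal.ofReal J := by
          rw [ENNReal.ofReal_add (by positivity) (by positivity),
            ENNReal.ofReal_mul (by norm_num), ENNReal.ofReal_mul (by norm_num), hmM]
      _ ≤ _ := by
          gcongr
          exact ofReal_integral_source_le hφ hF ht1 a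

end LindbladRodnianski
end
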